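/- Let 𝒩₄(N) denote the number of subsets S of {1,…,N⁴} with |S| = N and Σ_{i∈S} i = N(N⁴+1)/2. Then, as N → ∞, 𝒩₄(N) = (√3/π) · (N³·e)^N / N⁵ · (1 − 7/(30N) − 1249/(2520N²) + O(1/N³)); equivalently, (π/√3)·N⁵·(N³·e)^{−N}·𝒩₄(N) − (1 − 7/(30N) − 1249/(2520N²)) = O(1/N³). -/

import Mathlib

open Filter Asymptotics

/-- The number of magic series of order `N` for a 4-dimensional hypercube: subsets of
`{1,…,N⁴}` with `N` elements summing to the magic constant `N(N⁴+1)/2`. -/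
def magicTesseractSeries (N : ℕ) : ℕ :=
  ((Finset.Icc 1 (N ^ 4)).powerset.filter
    (fun S => S.card = N ∧ ∑ i ∈ S, i = N * (N ^ 4 + 1) / 2)).card

theorem Stirling.abs_log_stirlingSeq_sub_le (n : ℕ) (hn : 1 ≤ n) :
    |Real.log (Stirling.stirlingSeq n) - Real.log (√Real.pi) - 1 / (12 * (n : ℝ))| ≤
      1 / (n : ℝ) ^ 3 := by
  have hlim : Tendsto (fun n : ℕ => Real.log (Stirling.stirlingSeq (n + 1))) atTop
      (nhds (Real.log (√Real.pi))) :=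
    ((Stirling.tendsto_stirlingSeq_sqrt_pi.comp (tendsto_add_atTop_nat 1)).log
      (Real.sqrt_ne_zero'.2 Real.pi_pos))
  have hinv : Tendsto (fun n : ℕ => 1 / (((n + 1 : ℕ) : ℝ))) atTop (nhds 0) :=
    tendsto_one_div_atTop_nhds_zero_nat.comp (tendsto_add_atTop_nat 1)
  set b : ℕ → ℝ := fun n => Real.log (Stirling.stirlingSeq (n + 1)) -
    1 / 12 * (1 / ((n + 1 : ℕ) : ℝ)) with hb
  set c : ℕ → ℝ := fun n => b n + (1 / ((n + 1 : ℕ) : ℝ)) ^ 3 with hc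
  have hblim : Tendsto b atTop (nhds (Real.log (√Real.pi))) := by
    simpa only [mul_zero, sub_zero] using hlim.sub (hinv.const_mul (1 / 12))
  have hclim : Tendsto c atTop (nhds (Real.log (√Real.pi))) := by
    simpa only [ne_eq, OfNat.ofNat_ne_zero, not_false_eq_true, zero_pow, add_zero] using
      hblim.add (hinv.pow 3)
  have hbmono : Monotone b := by
    refine monotone_nat_of_le_succ fun m => ?_
    have h := Stirling.log_stirlingSeq_sdiff_le (m + 1)
    have e : 1 / (12 * ((m + 1 : ℕ) : ℝ) * (((m + 1 : ℕ) : ℝ) + 1)) =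
        1 / 12 * (1 / ((m + 1 : ℕ) : ℝ)) - 1 / 12 * (1 / ((m + 1 + 1 : ℕ) : ℝ)) := by
      push_cast
      field
    rw [e] at h
    simp only [hb]
    linarith
  have hcanti : Antitone c := by
    refine antitone_nat_of_succ_le fun m => ?_
    have h := le_hasSum (Stirling.log_stirlingSeq_sdiff_hasSum m) 0 (fun k _ => by positivity)
    have e : 1 / 12 * (1 / ((m + 1 : ℕ) : ℝ)) - 1 / 12 * (1 / ((m + 1 + 1 : ℕ) : ℝ)) ≤
        1 / (2 * ((0 + 1 : ℕ) : ℝ) + 1) *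
          ((1 / (2 * ((m + 1 : ℕ) : ℝ) + 1)) ^ 2) ^ (0 + 1) +
        ((1 / ((m + 1 : ℕ) : ℝ)) ^ 3 - (1 / ((m + 1 + 1 : ℕ) : ℝ)) ^ 3) := by
      rw [Nat.cast_add 0 1, Nat.cast_zero, Nat.cast_add (m + 1) 1, Nat.cast_add m 1, Nat.cast_one]
      have hm : (0 : ℝ) ≤ m := m.cast_nonneg
      generalize (m : ℝ) = x at hm
      rw [← sub_nonneg, show 2 * (x + 1) + 1 = 2 * x + 3 by ring]
      have : 1 / (2 * ((0 : ℝ) + 1) + 1) * ((1 / (2 * x + 3)) ^ 2) ^ (0 + 1) +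
          ((1 / (x + 1)) ^ 3 - (1 / (x + 1 + 1)) ^ 3) -
          (1 / 12 * (1 / (x + 1)) - 1 / 12 * (1 / (x + 1 + 1))) =
          (12 * (2 * x + 3) ^ 2 * (3 * x ^ 2 + 9 * x + 7) - (x + 1) ^ 2 * (x + 2) ^ 2) /
          (12 * (x + 1) ^ 3 * (x + 2) ^ 3 * (2 * x + 3) ^ 2) := by
        rw [show x + 1 + 1 = x + 2 by ring, zero_add, zero_add, pow_one]
        field_simp
        ring
      rw [this]
      apply div_nonneg _ (by positivity)
      ring_nf
      positivity
    simp only [hc, hb]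
    linarith
  obtain ⟨m, rfl⟩ : ∃ m, n = m + 1 := ⟨n - 1, by omega⟩
  have h1 := hbmono.ge_of_tendsto hblim m
  have h2 := hcanti.le_of_tendsto hclim m
  simp only [hc, hb, one_div_pow] at h1 h2
  have e : 1 / (12 * ((m + 1 : ℕ) : ℝ)) = 1 / 12 * (1 / ((m + 1 : ℕ) : ℝ)) := by field
  have h3 : 0 ≤ 1 / ((m + 1 : ℕ) : ℝ) ^ 3 := by positivity
  rw [abs_le, e]
  constructor <;> linarith

/-- The tuples with entries in `{1,…,M}` and prescribed sum `s`. -/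
def tuplesWithSum (N M s : ℕ) : Finset (Fin N → ℕ) :=
  {f ∈ Fintype.piFinset (fun _ : Fin N => Finset.Icc 1 M) | ∑ i, f i = s}

theorem mem_tuplesWithSum {N M s : ℕ} {f : Fin N → ℕ} :
    f ∈ tuplesWithSum N M s ↔ (∀ i, f i ∈ Finset.Icc 1 M) ∧ ∑ i, f i = s := by
  simp only [tuplesWithSum, Finset.mem_filter, Fintype.mem_piFinset]

theorem card_filter_injective_tuplesWithSum (N M s : ℕ) :
    ((tuplesWithSum N M s).filter Function.Injective).card =
      ((Finset.Icc 1 M).powerset.filter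
        (fun S => S.card = N ∧ ∑ i ∈ S, i = s)).card * N.factorial := by
  classical
  rw [Finset.card_eq_sum_card_fiberwise (f := fun f : Fin N → ℕ => Finset.univ.image f)
    (t := (Finset.Icc 1 M).powerset.filter (fun S => S.card = N ∧ ∑ i ∈ S, i = s))]
  · refine (Finset.sum_congr rfl fun S hS => ?_).trans (Finset.sum_const _)
    simp only [Finset.mem_filter, Finset.mem_powerset] at hS
    obtain ⟨hSM, hcard, hsum⟩ := hS
    have : ((tuplesWithSum N M s).filter Function.Injective).filter
        (fun f => Finset.univ.image f = S) =
        (Finset.univ : Finset (Fin N ↪ S)).image (fun e i => (e i : ℕ)) := by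
      ext f
      simp only [Finset.mem_filter, mem_tuplesWithSum, Finset.mem_image, Finset.mem_univ, true_and]
      constructor
      · rintro ⟨⟨-, hinj⟩, himg⟩
        refine ⟨⟨fun i => ⟨f i, himg ▸ Finset.mem_image_of_mem f (Finset.mem_univ i)⟩,
          fun i j hij => hinj (congrArg Subtype.val hij)⟩, rfl⟩
      · rintro ⟨e, rfl⟩
        have hinj : Function.Injective (fun i => (e i : ℕ)) :=
          Subtype.val_injective.comp e.injective
        have himg : Finset.univ.image (fun i => (e i : ℕ)) = S := by
          apply Finset.eq_of_subset_of_card_le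
          · intro x hx
            obtain ⟨i, -, rfl⟩ := Finset.mem_image.1 hx
            exact (e i).2
          · rw [Finset.card_image_of_injective _ hinj, hcard, Finset.card_univ, Fintype.card_fin]
        refine ⟨⟨⟨fun i => hSM (e i).2, ?_⟩, hinj⟩, himg⟩
        rw [← hsum]
        have h := Finset.sum_image (f := fun x => x) (s := Finset.univ) hinj.injOn
        rw [himg] at h
        exact h.symm
    rw [this, Finset.card_image_of_injective, Finset.card_univ, Fintype.card_embedding_eq,
      Fintype.card_coe, Fintype.card_fin, hcard, Nat.descFactorial_self]
    intro e e' h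
    ext i
    exact congrFun h i
  · intro f hf
    simp only [Finset.coe_filter, Set.mem_ofPred_eq, mem_tuplesWithSum] at hf
    obtain ⟨⟨hM, hsum⟩, hinj⟩ := hf
    simp only [Finset.coe_filter, Set.mem_ofPred_eq, Finset.mem_powerset]
    refine ⟨fun x hx => ?_, ?_, ?_⟩
    · obtain ⟨i, -, rfl⟩ := Finset.mem_image.1 hx
      exact hM i
    · rw [Finset.card_image_of_injective _ hinj, Finset.card_univ, Fintype.card_fin]
    · rw [Finset.sum_image hinj.injOn, hsum]

/-- The pairs `(i, j)` of indices with `i < j`. -/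
def indexPairs (N : ℕ) : Finset (Fin N × Fin N) := {p | p.1 < p.2}

theorem card_indexPairs (N : ℕ) : (indexPairs N).card = N.choose 2 := by
  have h (j : Fin N) : (∑ i : Fin N, if i < j then 1 else 0) = (j : ℕ) := by
    rw [← Finset.card_filter, Finset.filter_gt_eq_Iio, Fin.card_Iio]
  rw [indexPairs, Finset.card_filter, Fintype.sum_prod_type_right]
  simp only [h]
  rw [Fin.sum_univ_eq_sum_range (fun i => i), Finset.sum_range_id, Nat.choose_two_right]

/-- The Bonferroni inequalities for the number of injective members of a family of functions. -/
theorem abs_card_filter_injective_sub_le {N : ℕ} (A : Finset (Fin N → ℕ)) :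
    |((A.filter Function.Injective).card : ℝ) -
      (A.card - ∑ p ∈ indexPairs N, ((A.filter (fun f => f p.1 = f p.2)).card : ℝ))| ≤
      ∑ q ∈ (indexPairs N).offDiag,
        ((A.filter (fun f => f q.1.1 = f q.1.2 ∧ f q.2.1 = f q.2.2)).card : ℝ) := by
  classical
  set c : (Fin N → ℕ) → ℕ := fun f => ((indexPairs N).filter (fun p => f p.1 = f p.2)).card with hc
  have h1 : ∑ p ∈ indexPairs N, ((A.filter (fun f => f p.1 = f p.2)).card : ℝ) =
      ∑ f ∈ A, (c f : ℝ) := by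
    simp only [hc, Finset.card_filter, Nat.cast_sum]
    exact Finset.sum_comm
  have h2 : ∑ q ∈ (indexPairs N).offDiag,
      ((A.filter (fun f => f q.1.1 = f q.1.2 ∧ f q.2.1 = f q.2.2)).card : ℝ) =
      ∑ f ∈ A, ((c f : ℝ) * c f - c f) := by
    have h (f : Fin N → ℕ) : (c f : ℝ) * c f - c f =
        (((indexPairs N).offDiag.filter
          (fun q => f q.1.1 = f q.1.2 ∧ f q.2.1 = f q.2.2)).card : ℝ) := by
      have : (indexPairs N).offDiag.filter (fun q => f q.1.1 = f q.1.2 ∧ f q.2.1 = f q.2.2) =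
          ((indexPairs N).filter (fun p => f p.1 = f p.2)).offDiag := by
        ext q
        simp only [Finset.mem_filter, Finset.mem_offDiag]
        tauto
      rw [this, Finset.offDiag_card, Nat.cast_sub (Nat.le_mul_self _), Nat.cast_mul]
    simp only [h, Finset.card_filter, Nat.cast_sum]
    exact Finset.sum_comm
  rw [h1, h2, Finset.card_filter, Finset.card_eq_sum_ones]
  push_cast
  rw [← Finset.sum_sub_distrib, ← Finset.sum_sub_distrib]
  refine (Finset.abs_sum_le_sum_abs _ _).trans (Finset.sum_le_sum fun f _ => ?_)
  split_ifs with hinj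
  · have : c f = 0 := by
      rw [hc, Finset.card_eq_zero, Finset.filter_eq_empty_iff]
      intro p hp h
      simp only [indexPairs, Finset.mem_filter, Finset.mem_univ, true_and] at hp
      exact hp.ne (hinj h)
    simp [this]
  · have : 1 ≤ c f := by
      simp only [Function.Injective, not_forall] at hinj
      obtain ⟨i, j, hij, hne⟩ := hinj
      rw [hc, Finset.one_le_card]
      rcases lt_or_gt_of_ne hne with h | h
      · exact ⟨(i, j), by simp [indexPairs, h, hij]⟩
      · exact ⟨(j, i), by simp [indexPairs, h, hij]⟩
    rcases this.eq_or_lt with h | h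
    · simp [← h]
    · have h' : (2 : ℝ) ≤ c f := by exact_mod_cast h
      rw [abs_le]
      constructor <;> nlinarith

theorem card_le_of_two_constraints {N M s : ℕ} {a a' b b' c : Fin N} (hab : a ≠ b) (hca : c ≠ a)
    (hcb : c ≠ b) (ha'a : a' ≠ a) (ha'b : a' ≠ b) (ha'c : a' ≠ c) (hb'a : b' ≠ a) (hb'b : b' ≠ b)
    (hb'c : b' ≠ c) :
    ((tuplesWithSum N M s).filter (fun f => f a = f a' ∧ f b = f b')).card ≤ M ^ (N - 3) := by
  classical
  set D : Finset (Fin N) := {a, b, c} with hD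
  have hDcard : D.card = 3 := Finset.card_eq_three.2 ⟨a, b, c, hab, hca.symm, hcb.symm, rfl⟩
  have hmem (k : Fin N) : k ∉ D ↔ k ≠ a ∧ k ≠ b ∧ k ≠ c := by simp [hD]
  calc _ ≤ (Fintype.piFinset (fun _ : {k // k ∉ D} => Finset.Icc 1 M)).card := by
        refine Finset.card_le_card_of_injOn (fun f k => f k) ?_ ?_
        · intro f hf
          simp only [Finset.coe_filter, Set.mem_ofPred_eq, mem_tuplesWithSum] at hf
          simp only [Finset.mem_coe, Fintype.mem_piFinset]
          exact fun k => hf.1.1 k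
        · intro f hf g hg hfg
          simp only [Finset.coe_filter, Set.mem_ofPred_eq, mem_tuplesWithSum] at hf hg
          have hout (k : Fin N) (hk : k ∉ D) : f k = g k := congrFun hfg ⟨k, hk⟩
          have hfa : f a = g a := by
            rw [hf.2.1, hg.2.1, hout a' ((hmem a').2 ⟨ha'a, ha'b, ha'c⟩)]
          have hfb : f b = g b := by
            rw [hf.2.2, hg.2.2, hout b' ((hmem b').2 ⟨hb'a, hb'b, hb'c⟩)]
          have hne (k : Fin N) (hk : k ≠ c) : f k = g k := by
            by_cases h1 : k = a
            · rw [h1, hfa]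
            by_cases h2 : k = b
            · rw [h2, hfb]
            exact hout k ((hmem k).2 ⟨h1, h2, hk⟩)
          have hfc : f c = g c := by
            have h := hf.1.2.trans hg.1.2.symm
            rw [← Finset.add_sum_erase _ _ (Finset.mem_univ c),
              ← Finset.add_sum_erase _ g (Finset.mem_univ c),
              Finset.sum_congr rfl fun k hk => hne k (Finset.ne_of_mem_erase hk)] at h
            exact Nat.add_right_cancel h
          funext k
          by_cases hk : k = c
          · rw [hk, hfc]
          · exact hne k hk
    _ = M ^ (N - 3) := by
        rw [Fintype.card_piFinset, Finset.prod_const, Nat.card_Icc, Nat.add_sub_cancel,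
          Finset.card_univ, Fintype.card_subtype_compl, Fintype.card_fin, Fintype.card_coe, hDcard]

theorem card_tuplesWithSum_two_coincidences_le {N M s : ℕ} (hN : 5 ≤ N)
    {q : (Fin N × Fin N) × (Fin N × Fin N)} (hq : q ∈ (indexPairs N).offDiag) :
    ((tuplesWithSum N M s).filter
      (fun f => f q.1.1 = f q.1.2 ∧ f q.2.1 = f q.2.2)).card ≤ M ^ (N - 3) := by
  classical
  obtain ⟨⟨i, j⟩, ⟨k, l⟩⟩ := q
  simp only [Finset.mem_offDiag, indexPairs, Finset.mem_filter, Finset.mem_univ, true_and, ne_eq,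
    Prod.mk.injEq, not_and] at hq
  obtain ⟨hij, hkl, hne⟩ := hq
  obtain ⟨c, hc⟩ : ∃ c, c ∉ ({i, j, k, l} : Finset (Fin N)) := by
    by_contra! h
    have := Finset.card_le_card (fun x _ => h x : Finset.univ ⊆ ({i, j, k, l} : Finset (Fin N)))
    rw [Finset.card_univ, Fintype.card_fin] at this
    have := this.trans Finset.card_le_four
    omega
  simp only [Finset.mem_insert, Finset.mem_singleton, not_or] at hc
  obtain ⟨hci, hcj, hck, hcl⟩ := hc
  have key {a a' b b' : Fin N} (hab : a ≠ b) (hca : c ≠ a)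
      (hcb : c ≠ b) (ha'a : a' ≠ a) (ha'b : a' ≠ b) (ha'c : a' ≠ c) (hb'a : b' ≠ a) (hb'b : b' ≠ b)
      (hb'c : b' ≠ c) (h : ∀ f : Fin N → ℕ, f i = f j → f k = f l → f a = f a' ∧ f b = f b') :
      ((tuplesWithSum N M s).filter (fun f => f i = f j ∧ f k = f l)).card ≤ M ^ (N - 3) :=
    (Finset.card_le_card (Finset.monotone_filter_right _ fun f _ hf => h f hf.1 hf.2)).trans
      (card_le_of_two_constraints hab hca hcb ha'a ha'b ha'c hb'a hb'b hb'c)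
  by_cases hjl : j = l
  · subst hjl
    exact key (a := i) (a' := j) (b := k) (b' := j) (by grind) hci hck hij.ne' hkl.ne'
      (Ne.symm hcj) hij.ne' hkl.ne' (Ne.symm hcj) fun f h1 h2 => ⟨h1, h2⟩
  by_cases hil : i = l
  · subst hil
    exact key (a := j) (a' := k) (b := i) (b' := k) hjl hcj hci (hkl.trans hij).ne hkl.ne
      (Ne.symm hck) (hkl.trans hij).ne hkl.ne (Ne.symm hck)
      fun f h1 h2 => ⟨(h2.trans h1).symm, h2.symm⟩
  by_cases hkj : k = j
  · subst hkj
    exact key (a := k) (a' := i) (b := l) (b' := i) hjl hcj hcl hij.ne (hij.trans hkl).ne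
      (Ne.symm hci) hij.ne (hij.trans hkl).ne (Ne.symm hci)
      fun f h1 h2 => ⟨h1.symm, (h1.trans h2).symm⟩
  exact key (a := j) (a' := i) (b := l) (b' := k) hjl hcj hcl hij.ne hil (Ne.symm hci) hkj hkl.ne
    (Ne.symm hck) fun f h1 h2 => ⟨h1.symm, h2.symm⟩

/-- The centred Dirichlet kernel `sin (M u) / sin u`, as a finite sum of cosines. -/
noncomputable def dirichletSum (M : ℕ) (u : ℝ) : ℝ :=
  ∑ x ∈ Finset.Icc 1 M, Real.cos ((2 * (x : ℝ) - (M + 1)) * u)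

theorem continuous_dirichletSum (M : ℕ) : Continuous (dirichletSum M) := by
  unfold dirichletSum
  fun_prop

theorem dirichletSum_neg (M : ℕ) (u : ℝ) : dirichletSum M (-u) = dirichletSum M u := by
  simp only [dirichletSum, mul_neg, Real.cos_neg]

theorem abs_dirichletSum_le (M : ℕ) (u : ℝ) : |dirichletSum M u| ≤ M := by
  refine (Finset.abs_sum_le_sum_abs _ _).trans
    ((Finset.sum_le_sum fun x _ => Real.abs_cos_le_one _).trans ?_)
  simp

theorem sin_mul_dirichletSum (M : ℕ) (u : ℝ) :
    Real.sin u * dirichletSum M u = Real.sin (M * u) := by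
  have h (n : ℕ) : 2 * (Real.sin u * ∑ x ∈ Finset.Icc 1 n, Real.cos ((2 * (x : ℝ) - (M + 1)) * u)) =
      Real.sin ((2 * n - M) * u) + Real.sin (M * u) := by
    induction n with
    | zero => simp [Real.sin_neg]
    | succ n ih =>
      rw [Finset.sum_Icc_succ_top (by omega), mul_add, mul_add, ih]
      push_cast
      have e1 : (2 * ((n : ℝ) + 1) - M) * u = (2 * ((n : ℝ) + 1) - (M + 1)) * u + u := by ring
      have e2 : (2 * (n : ℝ) - M) * u = (2 * ((n : ℝ) + 1) - (M + 1)) * u - u := by ring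
      rw [e1, e2, Real.sin_add, Real.sin_sub]
      ring
  have := h M
  rw [show 2 * (M : ℝ) - M = M by ring] at this
  unfold dirichletSum
  linarith

theorem sum_exp_eq_dirichletSum (M : ℕ) (u : ℝ) :
    ∑ x ∈ Finset.Icc 1 M, Complex.exp (((2 * (x : ℝ) - (M + 1)) * u : ℝ) * Complex.I) =
      (dirichletSum M u : ℂ) := by
  have hsin : ∑ x ∈ Finset.Icc 1 M, Real.sin ((2 * (x : ℝ) - (M + 1)) * u) = 0 := by
    have : ∑ x ∈ Finset.Icc 1 M, Real.sin ((2 * (x : ℝ) - (M + 1)) * u) =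
        ∑ x ∈ Finset.Icc 1 M, -Real.sin ((2 * (x : ℝ) - (M + 1)) * u) := by
      refine Finset.sum_nbij' (fun x => M + 1 - x) (fun x => M + 1 - x) ?_ ?_ ?_ ?_ ?_
      · intro x hx; simp only [Finset.mem_Icc] at hx ⊢; omega
      · intro x hx; simp only [Finset.mem_Icc] at hx ⊢; omega
      · intro x hx; simp only [Finset.mem_Icc] at hx; omega
      · intro x hx; simp only [Finset.mem_Icc] at hx; omega
      · intro x hx
        simp only [Finset.mem_Icc] at hx
        rw [Nat.cast_sub (by omega), ← Real.sin_neg]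
        congr 1
        push_cast
        ring
    rw [Finset.sum_neg_distrib] at this
    linarith
  simp only [Complex.exp_mul_I, Finset.sum_add_distrib, ← Finset.sum_mul, ← Complex.ofReal_cos,
    ← Complex.ofReal_sin, ← Complex.ofReal_sum, hsin, dirichletSum]
  simp

theorem integral_exp_two_mul_int (m : ℤ) :
    ∫ u in (-(Real.pi / 2))..(Real.pi / 2), Complex.exp ((2 * (m : ℝ) * u : ℝ) * Complex.I) =
      if m = 0 then (Real.pi : ℂ) else 0 := by
  split_ifs with hm
  · subst hm
    simp
  · have hc : (2 * (m : ℂ) * Complex.I) ≠ 0 := by simp [hm]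
    have h := integral_exp_mul_complex (a := -(Real.pi / 2)) (b := Real.pi / 2) hc
    have e (u : ℝ) : ((2 * (m : ℝ) * u : ℝ) : ℂ) * Complex.I = (2 * (m : ℂ) * Complex.I) * u := by
      push_cast
      ring
    simp only [e]
    rw [h, div_eq_zero_iff]
    left
    rw [sub_eq_zero, Complex.exp_eq_exp_iff_exists_int]
    refine ⟨m, ?_⟩
    push_cast
    ring

theorem pi_mul_card_filter_sum_eq {N M s : ℕ} (hs : 2 * s = N * (M + 1))
    (B : Fin N → Finset ℕ) :
    (Real.pi : ℂ) * ((Fintype.piFinset B).filter (fun f => ∑ i, f i = s)).card =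
      ∫ u in (-(Real.pi / 2))..(Real.pi / 2),
        ∏ k, ∑ x ∈ B k, Complex.exp (((2 * (x : ℝ) - (M + 1)) * u : ℝ) * Complex.I) := by
  have h (u : ℝ) : ∏ k, ∑ x ∈ B k, Complex.exp (((2 * (x : ℝ) - (M + 1)) * u : ℝ) * Complex.I) =
      ∑ f ∈ Fintype.piFinset B, Complex.exp
        ((2 * (((∑ i, f i : ℕ) : ℤ) - (s : ℤ) : ℤ) * u : ℝ) * Complex.I) := by
    rw [Finset.prod_univ_sum]
    refine Finset.sum_congr rfl fun f _ => ?_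
    rw [← Complex.exp_sum, ← Finset.sum_mul, ← Complex.ofReal_sum, ← Finset.sum_mul,
      Finset.sum_sub_distrib, ← Finset.mul_sum]
    have hs' : (2 : ℝ) * s = N * (M + 1) := by exact_mod_cast hs
    congr 4
    simp only [Finset.sum_const, Finset.card_univ, Fintype.card_fin, nsmul_eq_mul]
    push_cast
    linarith
  simp only [h]
  rw [intervalIntegral.integral_finsetSum fun f _ =>
    Continuous.intervalIntegrable (by fun_prop) _ _]
  simp only [integral_exp_two_mul_int, sub_eq_zero, Nat.cast_inj]
  rw [← Finset.sum_filter, Finset.sum_const, nsmul_eq_mul, mul_comm]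

theorem pi_mul_card_tuplesWithSum {N M s : ℕ} (hs : 2 * s = N * (M + 1)) :
    Real.pi * ((tuplesWithSum N M s).card : ℝ) =
      ∫ u in (-(Real.pi / 2))..(Real.pi / 2), dirichletSum M u ^ N := by
  have h := pi_mul_card_filter_sum_eq hs (fun _ => Finset.Icc 1 M)
  simp only [sum_exp_eq_dirichletSum, Finset.prod_const, Finset.card_univ, Fintype.card_fin] at h
  have e : (∫ u in (-(Real.pi / 2))..(Real.pi / 2), (dirichletSum M u : ℂ) ^ N) =
      ((∫ u in (-(Real.pi / 2))..(Real.pi / 2), dirichletSum M u ^ N : ℝ) : ℂ) := by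
    rw [← intervalIntegral.integral_ofReal]
    simp only [Complex.ofReal_pow]
  rw [e] at h
  exact_mod_cast h

theorem pi_mul_card_filter_coincidence {N M s : ℕ} (hs : 2 * s = N * (M + 1)) {p : Fin N × Fin N}
    (hp : p ∈ indexPairs N) :
    Real.pi * (((tuplesWithSum N M s).filter (fun f => f p.1 = f p.2)).card : ℝ) =
      ∫ u in (-(Real.pi / 2))..(Real.pi / 2),
        dirichletSum M (2 * u) * dirichletSum M u ^ (N - 2) := by
  classical
  have hne : p.1 ≠ p.2 := by
    simp only [indexPairs, Finset.mem_filter, Finset.mem_univ, true_and] at hp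
    exact hp.ne
  set B : ℕ → Fin N → Finset ℕ :=
    fun x k => if k ∈ ({p.1, p.2} : Finset (Fin N)) then {x} else Finset.Icc 1 M with hB
  have hcard : ((tuplesWithSum N M s).filter (fun f => f p.1 = f p.2)).card =
      ∑ x ∈ Finset.Icc 1 M, ((Fintype.piFinset (B x)).filter (fun f => ∑ i, f i = s)).card := by
    rw [Finset.card_eq_sum_card_fiberwise (f := fun f : Fin N → ℕ => f p.1)
      (t := Finset.Icc 1 M)]
    · refine Finset.sum_congr rfl fun x hx => congrArg Finset.card ?_
      ext f
      simp only [Finset.mem_filter, mem_tuplesWithSum, Fintype.mem_piFinset, hB]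
      constructor
      · rintro ⟨⟨⟨hM, hsum⟩, heq⟩, hfx⟩
        refine ⟨fun k => ?_, hsum⟩
        split_ifs with hk
        · simp only [Finset.mem_insert, Finset.mem_singleton] at hk ⊢
          rcases hk with rfl | rfl
          · exact hfx
          · rw [← heq, hfx]
        · exact hM k
      · rintro ⟨hf, hsum⟩
        have h1 : f p.1 = x := by simpa using hf p.1
        have h2 : f p.2 = x := by simpa using hf p.2
        refine ⟨⟨⟨fun k => ?_, hsum⟩, h1.trans h2.symm⟩, h1⟩
        have := hf k
        split_ifs at this with hk
        · rw [Finset.mem_singleton] at this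
          rwa [this]
        · exact this
    · intro f hf
      simp only [Finset.coe_filter, Set.mem_ofPred_eq, mem_tuplesWithSum] at hf
      exact hf.1.1 p.1
  have hprod (x : ℕ) (u : ℝ) :
      ∏ k, ∑ y ∈ B x k, Complex.exp (((2 * (y : ℝ) - (M + 1)) * u : ℝ) * Complex.I) =
      Complex.exp (((2 * (x : ℝ) - (M + 1)) * (2 * u) : ℝ) * Complex.I) *
        (dirichletSum M u : ℂ) ^ (N - 2) := by
    rw [← Finset.prod_mul_prod_compl {p.1, p.2}, Finset.prod_pair hne]
    have h3 : ∏ k ∈ ({p.1, p.2} : Finset (Fin N))ᶜ,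
        ∑ y ∈ B x k, Complex.exp (((2 * (y : ℝ) - (M + 1)) * u : ℝ) * Complex.I) =
        (dirichletSum M u : ℂ) ^ (N - 2) := by
      rw [Finset.prod_congr rfl (g := fun _ => (dirichletSum M u : ℂ)), Finset.prod_const,
        Finset.card_compl, Fintype.card_fin, Finset.card_pair hne]
      intro k hk
      simp only [hB, if_neg (Finset.mem_compl.1 hk), sum_exp_eq_dirichletSum]
    rw [h3]
    congr 1
    simp only [hB, Finset.mem_insert, Finset.mem_singleton, true_or, or_true, if_true,
      Finset.sum_singleton]
    rw [← Complex.exp_add]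
    congr 1
    push_cast
    ring
  have h (x : ℕ) := pi_mul_card_filter_sum_eq hs (B x)
  simp only [hprod] at h
  have key : ((Real.pi * (((tuplesWithSum N M s).filter (fun f => f p.1 = f p.2)).card : ℝ) : ℝ) :
      ℂ) = ((∫ u in (-(Real.pi / 2))..(Real.pi / 2),
        dirichletSum M (2 * u) * dirichletSum M u ^ (N - 2) : ℝ) : ℂ) := by
    have hcont := continuous_dirichletSum M
    rw [hcard, ← intervalIntegral.integral_ofReal]
    push_cast
    rw [Finset.mul_sum, Finset.sum_congr rfl fun x _ => h x,
      ← intervalIntegral.integral_finsetSum fun x _ =>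
        Continuous.intervalIntegrable (by fun_prop) _ _]
    simp only [← Finset.sum_mul, sum_exp_eq_dirichletSum]
  exact_mod_cast key

theorem nonneg_of_hasDerivAt_nonneg {f f' : ℝ → ℝ} (hf : ∀ x, HasDerivAt f (f' x) x) (h0 : f 0 = 0)
    (hf' : ∀ x, 0 ≤ x → 0 ≤ f' x) {x : ℝ} (hx : 0 ≤ x) : 0 ≤ f x := by
  have hmono : MonotoneOn f (Set.Ici 0) := by
    refine monotoneOn_of_deriv_nonneg (convex_Ici 0)
      (fun x _ => (hf x).continuousAt.continuousWithinAt)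
      (fun x _ => (hf x).differentiableAt.differentiableWithinAt) fun x hx => ?_
    rw [interior_Ici, Set.mem_Ioi] at hx
    rw [(hf x).deriv]
    exact hf' x hx.le
  simpa [h0] using hmono (Set.mem_Ici.2 le_rfl) (Set.mem_Ici.2 hx) hx

theorem Real.cos_le_taylor_four {x : ℝ} (hx : 0 ≤ x) :
    Real.cos x ≤ 1 - x ^ 2 / 2 + x ^ 4 / 24 := by
  have := nonneg_of_hasDerivAt_nonneg (f := fun x => 1 - x ^ 2 / 2 + x ^ 4 / 24 - Real.cos x)
    (f' := fun x => Real.sin x - (x - x ^ 3 / 6))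
    (fun x => by
      refine HasDerivAt.congr_deriv ((((hasDerivAt_const x (1 : ℝ)).sub
        ((hasDerivAt_pow 2 x).div_const 2)).add ((hasDerivAt_pow 4 x).div_const 24)).sub
        (Real.hasDerivAt_cos x)) ?_
      norm_num
      ring) (by simp)
    (fun x hx => by
      rcases hx.eq_or_lt with rfl | hx
      · simp
      · linarith [Real.sin_gt_sub_cube hx]) hx
  linarith

theorem Real.sin_le_taylor_five {x : ℝ} (hx : 0 ≤ x) :
    Real.sin x ≤ x - x ^ 3 / 6 + x ^ 5 / 120 := by
  have := nonneg_of_hasDerivAt_nonneg (f := fun x => x - x ^ 3 / 6 + x ^ 5 / 120 - Real.sin x)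
    (f' := fun x => 1 - x ^ 2 / 2 + x ^ 4 / 24 - Real.cos x)
    (fun x => by
      refine HasDerivAt.congr_deriv ((((hasDerivAt_id x).sub
        ((hasDerivAt_pow 3 x).div_const 6)).add ((hasDerivAt_pow 5 x).div_const 120)).sub
        (Real.hasDerivAt_sin x)) ?_
      norm_num
      ring) (by simp)
    (fun x hx => by linarith [Real.cos_le_taylor_four hx]) hx
  linarith

theorem Real.taylor_six_le_cos {x : ℝ} (hx : 0 ≤ x) :
    1 - x ^ 2 / 2 + x ^ 4 / 24 - x ^ 6 / 720 ≤ Real.cos x := by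
  have := nonneg_of_hasDerivAt_nonneg
    (f := fun x => Real.cos x - (1 - x ^ 2 / 2 + x ^ 4 / 24 - x ^ 6 / 720))
    (f' := fun x => x - x ^ 3 / 6 + x ^ 5 / 120 - Real.sin x)
    (fun x => by
      refine HasDerivAt.congr_deriv ((Real.hasDerivAt_cos x).sub
        ((((hasDerivAt_const x (1 : ℝ)).sub
        ((hasDerivAt_pow 2 x).div_const 2)).add ((hasDerivAt_pow 4 x).div_const 24)).sub
        ((hasDerivAt_pow 6 x).div_const 720))) ?_
      norm_num
      ring) (by simp)
    (fun x hx => by linarith [Real.sin_le_taylor_five hx]) hx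
  linarith

theorem Real.taylor_seven_le_sin {x : ℝ} (hx : 0 ≤ x) :
    x - x ^ 3 / 6 + x ^ 5 / 120 - x ^ 7 / 5040 ≤ Real.sin x := by
  have := nonneg_of_hasDerivAt_nonneg
    (f := fun x => Real.sin x - (x - x ^ 3 / 6 + x ^ 5 / 120 - x ^ 7 / 5040))
    (f' := fun x => Real.cos x - (1 - x ^ 2 / 2 + x ^ 4 / 24 - x ^ 6 / 720))
    (fun x => by
      refine HasDerivAt.congr_deriv ((Real.hasDerivAt_sin x).sub
        ((((hasDerivAt_id x).sub
        ((hasDerivAt_pow 3 x).div_const 6)).add ((hasDerivAt_pow 5 x).div_const 120)).sub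
        ((hasDerivAt_pow 7 x).div_const 5040))) ?_
      norm_num
      ring) (by simp)
    (fun x hx => by linarith [Real.taylor_six_le_cos hx]) hx
  linarith

theorem Real.cos_le_taylor_eight {x : ℝ} (hx : 0 ≤ x) :
    Real.cos x ≤ 1 - x ^ 2 / 2 + x ^ 4 / 24 - x ^ 6 / 720 + x ^ 8 / 40320 := by
  have := nonneg_of_hasDerivAt_nonneg
    (f := fun x => 1 - x ^ 2 / 2 + x ^ 4 / 24 - x ^ 6 / 720 + x ^ 8 / 40320 - Real.cos x)
    (f' := fun x => Real.sin x - (x - x ^ 3 / 6 + x ^ 5 / 120 - x ^ 7 / 5040))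
    (fun x => by
      refine HasDerivAt.congr_deriv (((((((hasDerivAt_const x (1 : ℝ)).sub
        ((hasDerivAt_pow 2 x).div_const 2)).add ((hasDerivAt_pow 4 x).div_const 24)).sub
        ((hasDerivAt_pow 6 x).div_const 720))).add ((hasDerivAt_pow 8 x).div_const 40320)).sub
        (Real.hasDerivAt_cos x)) ?_
      norm_num
      ring) (by simp)
    (fun x hx => by linarith [Real.taylor_seven_le_sin hx]) hx
  linarith

theorem Real.sin_le_taylor_nine {x : ℝ} (hx : 0 ≤ x) :
    Real.sin x ≤ x - x ^ 3 / 6 + x ^ 5 / 120 - x ^ 7 / 5040 + x ^ 9 / 362880 := by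
  have := nonneg_of_hasDerivAt_nonneg
    (f := fun x => x - x ^ 3 / 6 + x ^ 5 / 120 - x ^ 7 / 5040 + x ^ 9 / 362880 - Real.sin x)
    (f' := fun x => 1 - x ^ 2 / 2 + x ^ 4 / 24 - x ^ 6 / 720 + x ^ 8 / 40320 - Real.cos x)
    (fun x => by
      refine HasDerivAt.congr_deriv ((((((hasDerivAt_id x).sub
        ((hasDerivAt_pow 3 x).div_const 6)).add ((hasDerivAt_pow 5 x).div_const 120)).sub
        ((hasDerivAt_pow 7 x).div_const 5040)).add ((hasDerivAt_pow 9 x).div_const 362880)).sub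
        (Real.hasDerivAt_sin x)) ?_
      norm_num
      ring) (by simp)
    (fun x hx => by linarith [Real.cos_le_taylor_eight hx]) hx
  linarith

theorem Real.sinc_nonneg {x : ℝ} (h0 : 0 < x) (h2 : x ≤ 2) : 0 ≤ Real.sinc x := by
  rw [Real.sinc_of_ne_zero h0.ne']
  exact div_nonneg (Real.sin_nonneg_of_nonneg_of_le_pi h0.le (by linarith [Real.pi_gt_three])) h0.le

theorem Real.sinc_le_exp {x : ℝ} (h0 : 0 < x) (h2 : x ≤ 2) :
    Real.sinc x ≤ Real.exp (-(x ^ 2 / 6)) := by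
  rw [Real.sinc_of_ne_zero h0.ne', div_le_iff₀ h0]
  set w := x ^ 2 / 6 with hw
  have hw0 : 0 ≤ w := by positivity
  have hw1 : w ≤ 2 / 3 := by rw [hw]; nlinarith
  have hexp : 1 - w + w ^ 2 / 2 - w ^ 3 / 6 ≤ Real.exp (-w) := by
    have := nonneg_of_hasDerivAt_nonneg
      (f := fun w => 1 - (1 - w + w ^ 2 / 2 - w ^ 3 / 6) * Real.exp w)
      (f' := fun w => w ^ 3 / 6 * Real.exp w)
      (fun w => by
        refine HasDerivAt.congr_deriv ((hasDerivAt_const w (1 : ℝ)).sub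
          (((((hasDerivAt_const w (1 : ℝ)).sub (hasDerivAt_id w)).add
          ((hasDerivAt_pow 2 w).div_const 2)).sub ((hasDerivAt_pow 3 w).div_const 6)).mul
          (Real.hasDerivAt_exp w))) ?_
        norm_num
        ring) (by simp)
      (fun w hw => by positivity) hw0
    rw [Real.exp_neg, ← one_div, le_div_iff₀ (Real.exp_pos w)]
    linarith
  have hsin := Real.sin_le_taylor_five h0.le
  have h1 : x - x ^ 3 / 6 + x ^ 5 / 120 = (1 - w + 3 / 10 * w ^ 2) * x := by rw [hw]; ring
  rw [h1] at hsin
  refine hsin.trans (mul_le_mul_of_nonneg_right (le_trans ?_ hexp) h0.le)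
  nlinarith [sq_nonneg w, mul_nonneg (sq_nonneg w) (sub_nonneg.2 hw1)]

theorem Real.abs_sinc_sub_exp_le {x : ℝ} (h0 : 0 < x) (h2 : x ≤ 2) :
    |Real.sinc x - Real.exp (-(x ^ 2 / 6 + x ^ 4 / 180 + x ^ 6 / 2835))| ≤ x ^ 8 := by
  rcases le_or_gt x 1 with h1 | h1
  · set w := x ^ 2 / 6 + x ^ 4 / 180 + x ^ 6 / 2835 with hw
    set t := x ^ 2 with ht
    have ht0 : 0 ≤ t := by positivity
    have ht1 : t ≤ 1 := by rw [ht]; nlinarith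
    have hwt : w = t / 6 + t ^ 2 / 180 + t ^ 3 / 2835 := by rw [hw, ht]; ring
    have hw0 : 0 ≤ w := by rw [hwt]; positivity
    have ht2 : t ^ 2 ≤ t := by nlinarith
    have ht3 : t ^ 3 ≤ t := by nlinarith
    have hwle : w ≤ t / 2 := by rw [hwt]; linarith
    have hexp := Real.exp_bound (x := -w) (by rw [abs_neg, abs_of_nonneg hw0]; linarith)
      (n := 4) (by norm_num)
    simp only [Finset.sum_range_succ, Finset.sum_range_zero, Nat.factorial, abs_neg,
      abs_of_nonneg hw0] at hexp
    norm_num at hexp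
    have hw4 : w ^ 4 ≤ t ^ 4 / 16 := by
      calc w ^ 4 ≤ (t / 2) ^ 4 := by gcongr
        _ = t ^ 4 / 16 := by ring
    have hsinc : |Real.sinc x - (1 - t / 6 + t ^ 2 / 120 - t ^ 3 / 5040)| ≤ t ^ 4 / 16 := by
      rw [Real.sinc_of_ne_zero h0.ne']
      have e1 := Real.taylor_seven_le_sin h0.le
      have e2 := Real.sin_le_taylor_nine h0.le
      have e3 : Real.sin x / x - (1 - t / 6 + t ^ 2 / 120 - t ^ 3 / 5040) =
          (Real.sin x - (x - x ^ 3 / 6 + x ^ 5 / 120 - x ^ 7 / 5040)) / x := by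
        rw [ht]
        field
      have e4 : x ^ 9 = t ^ 4 * x := by rw [ht]; ring
      have h9 : 0 ≤ x ^ 9 := by positivity
      rw [e3, abs_div, abs_of_pos h0, div_le_iff₀ h0, abs_of_nonneg (by linarith)]
      nlinarith
    have hpoly : |(1 - w + w ^ 2 / 2 - w ^ 3 / 6) - (1 - t / 6 + t ^ 2 / 120 - t ^ 3 / 5040)| ≤
        t ^ 4 / 2 := by
      have e : (1 - w + w ^ 2 / 2 - w ^ 3 / 6) - (1 - t / 6 + t ^ 2 / 120 - t ^ 3 / 5040) =
          -(t ^ 4 * (1 / 340200 + t / 181440 + 1507 / 5143824000 * t ^ 2 + 61 / 3857868000 * t ^ 3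
            + t ^ 4 / 2893401000 + t ^ 5 / 136713197250)) := by
        rw [hwt]
        ring
      have p (k : ℕ) : t ^ k ≤ 1 := pow_le_one₀ ht0 ht1
      rw [e, abs_neg, abs_of_nonneg (by positivity), div_eq_mul_one_div (t ^ 4) 2]
      refine mul_le_mul_of_nonneg_left ?_ (by positivity)
      linarith [p 2, p 3, p 4, p 5]
    have e8 : x ^ 8 = t ^ 4 := by rw [ht]; ring
    rw [e8]
    rw [abs_le] at *
    have ht4 : 0 ≤ t ^ 4 := by positivity
    constructor <;> linarith
  · have hs0 := Real.sinc_nonneg h0 h2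
    have hs1 := Real.sinc_le_one x
    have he0 := Real.exp_pos (-(x ^ 2 / 6 + x ^ 4 / 180 + x ^ 6 / 2835))
    have he1 : Real.exp (-(x ^ 2 / 6 + x ^ 4 / 180 + x ^ 6 / 2835)) ≤ 1 :=
      Real.exp_le_one_iff.2 (neg_nonpos.2 (by positivity))
    have := one_le_pow₀ h1.le (n := 8)
    rw [abs_le]
    constructor <;> linarith

theorem Real.abs_exp_neg_sub_quadratic_le {y : ℝ} (hy : 0 ≤ y) :
    |Real.exp (-y) - (1 - y + y ^ 2 / 2)| ≤ y ^ 3 := by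
  rcases le_or_gt y 1 with h | h
  · have hexp := Real.exp_bound (x := -y) (by rwa [abs_neg, abs_of_nonneg hy]) (n := 3)
      (by norm_num)
    simp only [Finset.sum_range_succ, Finset.sum_range_zero, Nat.factorial, abs_neg,
      abs_of_nonneg hy] at hexp
    norm_num at hexp
    have h3 : 0 ≤ y ^ 3 := by positivity
    rw [abs_le] at *
    constructor <;> linarith
  · have he0 := Real.exp_pos (-y)
    have he1 : Real.exp (-y) ≤ 1 := Real.exp_le_one_iff.2 (by linarith)
    rw [abs_le]
    constructor <;> nlinarith [sq_nonneg y, sq_nonneg (y - 1)]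

theorem abs_sinc_pow_sub_le {n : ℕ} (hn : 2 ≤ n) {v : ℝ} (h0 : 0 < v) (h2 : v ≤ 2) :
    |Real.sinc v ^ n - Real.exp (-(n / 6) * v ^ 2) *
      (1 - n * v ^ 4 / 180 - n * v ^ 6 / 2835 + n ^ 2 * v ^ 8 / 64800)| ≤
      (n * v ^ 8 + n ^ 2 * v ^ 10 + n ^ 3 * v ^ 12) * Real.exp (-(n / 12) * v ^ 2) := by
  have hn2 : (2 : ℝ) ≤ n := by exact_mod_cast hn
  set y := n * (v ^ 4 / 180 + v ^ 6 / 2835) with hy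
  set E := Real.exp (-(v ^ 2 / 6 + v ^ 4 / 180 + v ^ 6 / 2835)) with hE
  set G := Real.exp (-(n / 6) * v ^ 2) with hG
  set H := Real.exp (-(n / 12) * v ^ 2) with hH
  have hy0 : 0 ≤ y := by positivity
  have hv2 : v ^ 2 ≤ 4 := by nlinarith
  have hG0 : 0 < G := Real.exp_pos _
  have hGH : G ≤ H := Real.exp_le_exp.2 (by nlinarith [sq_nonneg v])
  have hEpow : E ^ n = G * Real.exp (-y) := by
    rw [hE, hG, ← Real.exp_nat_mul, ← Real.exp_add]
    congr 1
    rw [hy]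
    ring
  have h1 : |Real.sinc v ^ n - E ^ n| ≤ n * v ^ 8 * H := by
    have hs0 := Real.sinc_nonneg h0 h2
    have hs1 := Real.sinc_le_exp h0 h2
    have hE1 : E ≤ Real.exp (-(v ^ 2 / 6)) := Real.exp_le_exp.2 (by
      have : 0 ≤ v ^ 4 / 180 + v ^ 6 / 2835 := by positivity
      linarith)
    have hmax : max |Real.sinc v| |E| ≤ Real.exp (-(v ^ 2 / 6)) := by
      rw [abs_of_nonneg hs0, abs_of_pos (Real.exp_pos _)]
      exact max_le hs1 hE1
    have hpow : max |Real.sinc v| |E| ^ (n - 1) ≤ H := by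
      refine (pow_le_pow_left₀ (le_max_of_le_left (abs_nonneg _)) hmax _).trans ?_
      rw [← Real.exp_nat_mul, hH, Real.exp_le_exp, Nat.cast_sub (by omega)]
      push_cast
      nlinarith [sq_nonneg v]
    calc |Real.sinc v ^ n - E ^ n| ≤ |Real.sinc v - E| * n * max |Real.sinc v| |E| ^ (n - 1) :=
          abs_pow_sub_pow_le ..
      _ ≤ v ^ 8 * n * H := by
          gcongr
          exact Real.abs_sinc_sub_exp_le h0 h2
      _ = n * v ^ 8 * H := by ring
  have hyle : y ≤ n * v ^ 4 := by
    have h4 : 0 ≤ v ^ 4 := by positivity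
    have h6 : v ^ 6 ≤ 4 * v ^ 4 := by nlinarith
    rw [hy]
    gcongr
    linarith
  have h3 : |G * Real.exp (-y) - G * (1 - y + y ^ 2 / 2)| ≤ n ^ 3 * v ^ 12 * H := by
    rw [← mul_sub, abs_mul, abs_of_pos hG0, mul_comm]
    refine mul_le_mul ?_ hGH hG0.le (by positivity)
    calc _ ≤ y ^ 3 := Real.abs_exp_neg_sub_quadratic_le hy0
      _ ≤ (n * v ^ 4) ^ 3 := by gcongr
      _ = n ^ 3 * v ^ 12 := by ring
  have h4 : |G * (1 - y + y ^ 2 / 2) -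
      G * (1 - n * v ^ 4 / 180 - n * v ^ 6 / 2835 + n ^ 2 * v ^ 8 / 64800)| ≤
      n ^ 2 * v ^ 10 * H := by
    rw [← mul_sub, abs_mul, abs_of_pos hG0, mul_comm]
    refine mul_le_mul ?_ hGH hG0.le (by positivity)
    have e : (1 - y + y ^ 2 / 2) -
        (1 - n * v ^ 4 / 180 - n * v ^ 6 / 2835 + n ^ 2 * v ^ 8 / 64800) =
        n ^ 2 * v ^ 10 * (1 / 510300 + v ^ 2 / 16074450) := by
      rw [hy]
      ring
    rw [e, abs_of_nonneg (by positivity)]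
    refine mul_le_of_le_one_right (by positivity) (by linarith)
  rw [hEpow] at h1
  rw [abs_le] at *
  constructor <;> linarith

theorem abs_gaussian_mul_poly_le {n : ℕ} (hn : 2 ≤ n) {v : ℝ} (h2 : 2 < v) :
    |Real.exp (-(n / 6) * v ^ 2) *
      (1 - n * v ^ 4 / 180 - n * v ^ 6 / 2835 + n ^ 2 * v ^ 8 / 64800)| ≤
      (n * v ^ 8 + n ^ 2 * v ^ 10 + n ^ 3 * v ^ 12) * Real.exp (-(n / 12) * v ^ 2) := by
  have hn2 : (2 : ℝ) ≤ n := by exact_mod_cast hn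
  have hv2 : 1 ≤ v ^ 2 := by nlinarith
  have hv (k l : ℕ) (h : k ≤ l) : v ^ k ≤ v ^ l := pow_le_pow_right₀ (by linarith) h
  rw [abs_mul, abs_of_pos (Real.exp_pos _), mul_comm]
  refine mul_le_mul ?_ (Real.exp_le_exp.2 (by nlinarith)) (Real.exp_pos _).le (by positivity)
  have a0 : 1 ≤ n * v ^ 8 := by nlinarith [one_le_pow₀ (by linarith : 1 ≤ v) (n := 8)]
  have a4 : n * v ^ 4 ≤ n * v ^ 8 := by gcongr ?_ * ?_; exact hv _ _ (by norm_num)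
  have a6 : n * v ^ 6 ≤ n * v ^ 8 := by gcongr ?_ * ?_; exact hv _ _ (by norm_num)
  have a8 : n ^ 2 * v ^ 8 ≤ n ^ 2 * v ^ 10 := by gcongr ?_ * ?_; exact hv _ _ (by norm_num)
  have a12 : 0 ≤ n ^ 3 * v ^ 12 := by positivity
  have p4 : 0 ≤ n * v ^ 4 := by positivity
  have p6 : 0 ≤ n * v ^ 6 := by positivity
  have p8 : 0 ≤ n ^ 2 * v ^ 8 := by positivity
  rw [abs_le]
  constructor <;> linarith

theorem integrableOn_pow_mul_gaussian {b : ℝ} (hb : 0 < b) (k : ℕ) :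
    MeasureTheory.IntegrableOn (fun v : ℝ => v ^ k * Real.exp (-b * v ^ 2)) (Set.Ioi 0) := by
  have h := integrableOn_rpow_mul_exp_neg_mul_sq hb (s := k)
    (by linarith [k.cast_nonneg (α := ℝ)])
  simpa only [Real.rpow_natCast] using h

theorem integral_even_pow_mul_gaussian {b : ℝ} (hb : 0 < b) (m : ℕ) :
    ∫ v in Set.Ioi (0 : ℝ), v ^ (2 * m) * Real.exp (-b * v ^ 2) =
      √Real.pi / 2 / √b * (Nat.doubleFactorial (2 * m - 1) / (2 * b) ^ m) := by
  have h := integral_rpow_mul_exp_neg_mul_rpow (p := 2) (q := (2 * m : ℕ)) two_pos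
    (by linarith [(2 * m).cast_nonneg (α := ℝ)]) hb
  simp only [Real.rpow_natCast, Real.rpow_two] at h
  have e1 : (((2 * m : ℕ) : ℝ) + 1) / 2 = m + 1 / 2 := by push_cast; ring
  have e2 : -(((2 * m : ℕ) : ℝ) + 1) / 2 = -((m : ℝ) + 1 / 2) := by push_cast; ring
  rw [h, e1, e2, Real.Gamma_nat_add_half, Real.rpow_neg hb.le, Real.rpow_add hb,
    Real.rpow_natCast, ← Real.sqrt_eq_rpow, mul_pow]
  have : √b ≠ 0 := (Real.sqrt_pos.2 hb).ne'
  field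

theorem integrableOn_even_poly_mul_gaussian {b : ℝ} (hb : 0 < b) (c : ℕ → ℝ) (K : ℕ) :
    MeasureTheory.IntegrableOn
      (fun v : ℝ => (∑ i ∈ Finset.range K, c i * v ^ (2 * i)) * Real.exp (-b * v ^ 2))
      (Set.Ioi 0) := by
  simp only [Finset.sum_mul, mul_assoc]
  exact MeasureTheory.integrable_finsetSum _ fun i _ =>
    (integrableOn_pow_mul_gaussian hb (2 * i)).const_mul (c i)

theorem integral_even_poly_mul_gaussian {b : ℝ} (hb : 0 < b) (c : ℕ → ℝ) (K : ℕ) :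
    ∫ v in Set.Ioi (0 : ℝ), (∑ i ∈ Finset.range K, c i * v ^ (2 * i)) * Real.exp (-b * v ^ 2) =
      √Real.pi / 2 / √b *
        ∑ i ∈ Finset.range K, c i * (Nat.doubleFactorial (2 * i - 1) / (2 * b) ^ i) := by
  simp only [Finset.sum_mul, mul_assoc]
  rw [MeasureTheory.integral_finsetSum _ fun i _ =>
    (integrableOn_pow_mul_gaussian hb (2 * i)).const_mul (c i), Finset.mul_sum]
  refine Finset.sum_congr rfl fun i _ => ?_
  rw [MeasureTheory.integral_const_mul, integral_even_pow_mul_gaussian hb]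
  ring

theorem abs_intervalIntegral_le_integral_Ioi {h B : ℝ → ℝ} {a : ℝ} (ha : 0 ≤ a)
    (hB : MeasureTheory.IntegrableOn B (Set.Ioi 0)) (hB0 : ∀ v, 0 < v → 0 ≤ B v)
    (hh : ∀ v, 0 < v → v ≤ a → |h v| ≤ B v) :
    |∫ v in (0 : ℝ)..a, h v| ≤ ∫ v in Set.Ioi 0, B v := by
  have h1 : |∫ v in (0 : ℝ)..a, h v| ≤ ∫ v in (0 : ℝ)..a, B v := by
    refine intervalIntegral.norm_integral_le_of_norm_le (f := h) (g := B) ha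
      (Eventually.of_forall fun v hv => hh v hv.1 hv.2) ?_
    exact (intervalIntegrable_iff_integrableOn_Ioc_of_le ha).2
      (hB.mono_set Set.Ioc_subset_Ioi_self)
  refine h1.trans ?_
  rw [intervalIntegral.integral_of_le ha]
  refine MeasureTheory.setIntegral_mono_set hB ?_ Set.Ioc_subset_Ioi_self.eventuallyLE
  exact (MeasureTheory.ae_restrict_iff' measurableSet_Ioi).2
    (Eventually.of_forall fun v hv => hB0 v hv)

/-- The second-order Laplace expansion of `∫₀² sinc ^ n`. -/
theorem exists_abs_integral_sinc_pow_sub_le :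
    ∃ C, ∀ n : ℕ, 2 ≤ n →
      |√n * (∫ v in (0 : ℝ)..2, Real.sinc v ^ n) -
        √(6 * Real.pi) / 2 * (1 - 3 / (20 * n) - 13 / (1120 * n ^ 2))| ≤ C / (n : ℝ) ^ 3 := by
  refine ⟨√(12 * Real.pi) / 2 * (105 * 6 ^ 4 + 945 * 6 ^ 5 + 10395 * 6 ^ 6), fun n hn => ?_⟩
  have hn0 : (0 : ℝ) < n := by positivity
  set P : ℕ → ℝ := fun i => match i with
    | 0 => 1 | 2 => -(n / 180) | 3 => -(n / 2835) | 4 => n ^ 2 / 64800 | _ => 0 with hP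
  set R : ℕ → ℝ := fun i => match i with
    | 4 => n | 5 => n ^ 2 | 6 => n ^ 3 | _ => 0 with hR
  set p : ℝ → ℝ := fun v =>
    (∑ i ∈ Finset.range 5, P i * v ^ (2 * i)) * Real.exp (-(n / 6) * v ^ 2) with hp
  set r : ℝ → ℝ := fun v =>
    (∑ i ∈ Finset.range 7, R i * v ^ (2 * i)) * Real.exp (-(n / 12) * v ^ 2) with hr
  have hpv (v : ℝ) : p v = Real.exp (-(n / 6) * v ^ 2) *
      (1 - n * v ^ 4 / 180 - n * v ^ 6 / 2835 + n ^ 2 * v ^ 8 / 64800) := by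
    simp only [hp, Finset.sum_range_succ, Finset.sum_range_zero, hP]
    ring
  have hrv (v : ℝ) : r v = (n * v ^ 8 + n ^ 2 * v ^ 10 + n ^ 3 * v ^ 12) *
      Real.exp (-(n / 12) * v ^ 2) := by
    simp only [hr, Finset.sum_range_succ, Finset.sum_range_zero, hR]
    ring
  have hpint : MeasureTheory.IntegrableOn p (Set.Ioi 0) :=
    integrableOn_even_poly_mul_gaussian (by positivity) P 5
  have hrint : MeasureTheory.IntegrableOn r (Set.Ioi 0) :=
    integrableOn_even_poly_mul_gaussian (by positivity) R 7
  have hpI : ∫ v in Set.Ioi 0, p v = √Real.pi / 2 / √(n / 6) *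
      (1 - 3 / (20 * n) - 13 / (1120 * n ^ 2)) := by
    rw [hp, integral_even_poly_mul_gaussian (by positivity)]
    simp only [Finset.sum_range_succ, Finset.sum_range_zero, hP]
    congr 1
    norm_num [Nat.doubleFactorial]
    field
  have hrI : ∫ v in Set.Ioi 0, r v = √Real.pi / 2 / √(n / 12) *
      ((105 * 6 ^ 4 + 945 * 6 ^ 5 + 10395 * 6 ^ 6) / n ^ 3) := by
    rw [hr, integral_even_poly_mul_gaussian (by positivity)]
    simp only [Finset.sum_range_succ, Finset.sum_range_zero, hR, Nat.doubleFactorial]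
    congr 1
    push_cast
    field
  have hsint : MeasureTheory.IntegrableOn
      ((Set.Ioc 0 2).indicator fun v => Real.sinc v ^ n) (Set.Ioi 0) := by
    have hc := Real.continuous_sinc
    have : MeasureTheory.IntegrableOn (fun v => Real.sinc v ^ n) (Set.Ioc 0 2) :=
      (Continuous.integrableOn_Icc (by fun_prop)).mono_set Set.Ioc_subset_Icc_self
    exact (this.integrable_indicator measurableSet_Ioc).integrableOn
  have hsI : ∫ v in (0 : ℝ)..2, Real.sinc v ^ n =
      ∫ v in Set.Ioi 0, (Set.Ioc 0 2).indicator (fun v => Real.sinc v ^ n) v := by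
    rw [intervalIntegral.integral_of_le zero_le_two,
      MeasureTheory.setIntegral_indicator measurableSet_Ioc,
      Set.inter_eq_self_of_subset_right Set.Ioc_subset_Ioi_self]
  have hmain : |(∫ v in (0 : ℝ)..2, Real.sinc v ^ n) - ∫ v in Set.Ioi 0, p v| ≤
      ∫ v in Set.Ioi 0, r v := by
    rw [hsI, ← MeasureTheory.integral_sub hsint hpint]
    rw [← Real.norm_eq_abs]
    refine MeasureTheory.norm_integral_le_of_norm_le hrint ?_
    refine (MeasureTheory.ae_restrict_iff' measurableSet_Ioi).2
      (Eventually.of_forall fun v hv => ?_)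
    rw [Set.mem_Ioi] at hv
    rw [Real.norm_eq_abs, hpv, hrv]
    rcases le_or_gt v 2 with h2 | h2
    · rw [Set.indicator_of_mem (Set.mem_Ioc.2 ⟨hv, h2⟩)]
      exact abs_sinc_pow_sub_le hn hv h2
    · rw [Set.indicator_of_notMem (fun h => h2.not_ge h.2), zero_sub, abs_neg]
      exact abs_gaussian_mul_poly_le hn h2
  have hsq : √(n : ℝ) ≠ 0 := (Real.sqrt_pos.2 hn0).ne'
  have e1 : √(n : ℝ) * (√Real.pi / 2 / √(n / 6)) = √(6 * Real.pi) / 2 := by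
    rw [Real.sqrt_div hn0.le, Real.sqrt_mul (by norm_num : (0 : ℝ) ≤ 6)]
    field
  have e2 : √(n : ℝ) * (√Real.pi / 2 / √(n / 12)) = √(12 * Real.pi) / 2 := by
    rw [Real.sqrt_div hn0.le, Real.sqrt_mul (by norm_num : (0 : ℝ) ≤ 12)]
    field
  rw [hpI, hrI] at hmain
  have h := mul_le_mul_of_nonneg_left hmain (Real.sqrt_nonneg n)
  rw [← abs_of_nonneg (Real.sqrt_nonneg (n : ℝ)), ← abs_mul, abs_of_nonneg (Real.sqrt_nonneg _),
    mul_sub, ← mul_assoc, ← mul_assoc, e1, e2] at h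
  rwa [mul_div_assoc]

theorem Real.one_sub_sinc_sq_le {v : ℝ} (h0 : 0 < v) : |1 - Real.sinc v ^ 2| ≤ v ^ 2 := by
  have h1 : 1 - v ^ 2 / 6 ≤ Real.sinc v := by
    rw [Real.sinc_of_ne_zero h0.ne', le_div_iff₀ h0]
    linarith [Real.sin_gt_sub_cube h0]
  have h2 := Real.sinc_le_one v
  have h3 := Real.neg_one_le_sinc v
  rw [abs_le]
  constructor <;> nlinarith

/-- Inserting a factor `1 + O(v²)` perturbs `∫₀² sinc ^ n` by a relative `O(1 / n)`. -/
theorem exists_abs_integral_mul_sinc_pow_sub_le :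
    ∃ C, ∀ (n : ℕ) (g : ℝ → ℝ), 4 ≤ n → Continuous g → (∀ v, |g v - 1| ≤ 2 * v ^ 2) →
      |√n * (∫ v in (0 : ℝ)..2, g v * Real.sinc v ^ (n - 2)) -
        √n * (∫ v in (0 : ℝ)..2, Real.sinc v ^ n)| ≤ C / n := by
  refine ⟨√(12 * Real.pi) / 2 * 18, fun n g hn hg hg1 => ?_⟩
  have hn4 : (4 : ℝ) ≤ n := by exact_mod_cast hn
  have hn0 : (0 : ℝ) < n := by linarith
  have hc := Real.continuous_sinc
  set R : ℕ → ℝ := fun i => match i with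
    | 1 => 3 | _ => 0 with hR
  set r : ℝ → ℝ := fun v =>
    (∑ i ∈ Finset.range 2, R i * v ^ (2 * i)) * Real.exp (-(n / 12) * v ^ 2) with hr
  have hrv (v : ℝ) : r v = 3 * v ^ 2 * Real.exp (-(n / 12) * v ^ 2) := by
    simp only [hr, Finset.sum_range_succ, Finset.sum_range_zero, hR]
    ring
  have hrI : ∫ v in Set.Ioi 0, r v = √Real.pi / 2 / √(n / 12) * (18 / n) := by
    rw [hr, integral_even_poly_mul_gaussian (by positivity)]
    simp only [Finset.sum_range_succ, Finset.sum_range_zero, hR]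
    congr 1
    norm_num [Nat.doubleFactorial]
    field
  have hmain := abs_intervalIntegral_le_integral_Ioi
    (h := fun v => g v * Real.sinc v ^ (n - 2) - Real.sinc v ^ n) (B := r) zero_le_two
    (integrableOn_even_poly_mul_gaussian (by positivity) R 2)
    (fun v _ => by rw [hrv]; positivity)
    (fun v h0 h2 => by
      have e : g v * Real.sinc v ^ (n - 2) - Real.sinc v ^ n =
          ((g v - 1) + (1 - Real.sinc v ^ 2)) * Real.sinc v ^ (n - 2) := by
        have : Real.sinc v ^ n = Real.sinc v ^ 2 * Real.sinc v ^ (n - 2) := by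
          rw [← pow_add]
          congr 1
          omega
        rw [this]
        ring
      have hs0 := Real.sinc_nonneg h0 h2
      rw [e, abs_mul, abs_of_nonneg (pow_nonneg hs0 _), hrv]
      refine mul_le_mul ?_ ?_ (pow_nonneg hs0 _) (by positivity)
      · exact (abs_add_le _ _).trans (by linarith [hg1 v, Real.one_sub_sinc_sq_le h0])
      · refine (pow_le_pow_left₀ hs0 (Real.sinc_le_exp h0 h2) _).trans ?_
        rw [← Real.exp_nat_mul, Real.exp_le_exp, Nat.cast_sub (by omega)]
        push_cast
        nlinarith [sq_nonneg v])
  rw [intervalIntegral.integral_sub (Continuous.intervalIntegrable (by fun_prop) _ _)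
    (Continuous.intervalIntegrable (by fun_prop) _ _), hrI] at hmain
  have hsq : √(n : ℝ) ≠ 0 := (Real.sqrt_pos.2 hn0).ne'
  have e2 : √(n : ℝ) * (√Real.pi / 2 / √(n / 12)) = √(12 * Real.pi) / 2 := by
    rw [Real.sqrt_div hn0.le, Real.sqrt_mul (by norm_num : (0 : ℝ) ≤ 12)]
    field
  have h := mul_le_mul_of_nonneg_left hmain (Real.sqrt_nonneg n)
  rw [← abs_of_nonneg (Real.sqrt_nonneg (n : ℝ)), ← abs_mul, abs_of_nonneg (Real.sqrt_nonneg _),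
    mul_sub, ← mul_assoc, e2] at h
  rwa [mul_div_assoc]

/-- The Dirichlet kernel rescaled so that it converges to `Real.sinc` as `M → ∞`. -/
noncomputable def scaledDirichletSum (M : ℕ) (v : ℝ) : ℝ := dirichletSum M (v / M) / M

theorem continuous_scaledDirichletSum (M : ℕ) : Continuous (scaledDirichletSum M) :=
  ((continuous_dirichletSum M).comp (continuous_id.div_const _)).div_const _

theorem abs_scaledDirichletSum_le_one (M : ℕ) (v : ℝ) : |scaledDirichletSum M v| ≤ 1 := by
  rw [scaledDirichletSum, abs_div, Nat.abs_cast]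
  exact div_le_one_of_le₀ (abs_dirichletSum_le _ _) M.cast_nonneg

theorem mul_sin_mul_scaledDirichletSum {M : ℕ} (hM : M ≠ 0) (v : ℝ) :
    M * Real.sin (v / M) * scaledDirichletSum M v = Real.sin v := by
  have hM' : (M : ℝ) ≠ 0 := Nat.cast_ne_zero.2 hM
  have h := sin_mul_dirichletSum M (v / M)
  rw [mul_div_cancel₀ _ hM'] at h
  rw [← h, scaledDirichletSum]
  field

theorem abs_scaledDirichletSum_sub_sinc_le {M : ℕ} (hM : M ≠ 0) {v : ℝ} (h0 : 0 < v)
    (h2 : v ≤ 2) : |scaledDirichletSum M v - Real.sinc v| ≤ 1 / M ^ 2 := by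
  have hM' : (0 : ℝ) < M := Nat.cast_pos.2 (Nat.pos_of_ne_zero hM)
  have hu : 0 < v / M := by positivity
  have e : scaledDirichletSum M v - Real.sinc v =
      scaledDirichletSum M v * (v / M - Real.sin (v / M)) * (M / v) := by
    rw [Real.sinc_of_ne_zero h0.ne', ← mul_sin_mul_scaledDirichletSum hM]
    field
  have h1 : |v / M - Real.sin (v / M)| ≤ (v / M) ^ 3 / 6 := by
    rw [abs_of_nonneg (by linarith [Real.sin_lt hu])]
    linarith [Real.sin_gt_sub_cube hu]
  rw [e, abs_mul, abs_mul, abs_of_pos (by positivity : 0 < M / v)]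
  calc _ ≤ 1 * ((v / M) ^ 3 / 6) * (M / v) := by
        gcongr
        exact abs_scaledDirichletSum_le_one M v
    _ = v ^ 2 / 6 * (1 / M ^ 2) := by field
    _ ≤ 1 / M ^ 2 := mul_le_of_le_one_left (by positivity) (by nlinarith)

theorem abs_scaledDirichletSum_le_pi_div_four {M : ℕ} (hM : M ≠ 0) {v : ℝ} (h2 : 2 ≤ v)
    (hv : v ≤ M * (Real.pi / 2)) : |scaledDirichletSum M v| ≤ Real.pi / 4 := by
  have hM' : (0 : ℝ) < M := Nat.cast_pos.2 (Nat.pos_of_ne_zero hM)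
  have h1 : 2 / Real.pi * (v / M) ≤ Real.sin (v / M) :=
    Real.mul_le_sin (by positivity) ((div_le_iff₀' hM').2 hv)
  have h3 : 2 / Real.pi * v ≤ M * Real.sin (v / M) := by
    calc 2 / Real.pi * v = M * (2 / Real.pi * (v / M)) := by field
      _ ≤ _ := by gcongr
  have h4 : 4 / Real.pi ≤ M * Real.sin (v / M) :=
    le_trans (by rw [div_mul_eq_mul_div]; gcongr; linarith) h3
  have h5 : |M * Real.sin (v / M) * scaledDirichletSum M v| ≤ 1 := by
    rw [mul_sin_mul_scaledDirichletSum hM]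
    exact Real.abs_sin_le_one v
  have hpi := Real.pi_pos
  rw [abs_mul, abs_of_pos (lt_of_lt_of_le (by positivity) h4)] at h5
  have h6 := (mul_le_mul_of_nonneg_right h4 (abs_nonneg (scaledDirichletSum M v))).trans h5
  rw [div_mul_eq_mul_div, div_le_one hpi] at h6
  linarith

theorem abs_scaledDirichletSum_two_mul_sub_one_le {M : ℕ} (hM : M ≠ 0) (v : ℝ) :
    |scaledDirichletSum M (2 * v) - 1| ≤ 2 * v ^ 2 := by
  have hM' : (0 : ℝ) < M := Nat.cast_pos.2 (Nat.pos_of_ne_zero hM)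
  have e : scaledDirichletSum M (2 * v) - 1 =
      (∑ x ∈ Finset.Icc 1 M, (Real.cos ((2 * (x : ℝ) - (M + 1)) * (2 * v / M)) - 1)) / M := by
    rw [Finset.sum_sub_distrib, scaledDirichletSum, dirichletSum]
    simp
    field
  rw [e, abs_div, Nat.abs_cast, div_le_iff₀ hM']
  calc _ ≤ ∑ x ∈ Finset.Icc 1 M, 2 * v ^ 2 := by
        refine (Finset.abs_sum_le_sum_abs _ _).trans (Finset.sum_le_sum fun x hx => ?_)
        rw [Finset.mem_Icc] at hx
        have hx1 : (1 : ℝ) ≤ x := by exact_mod_cast hx.1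
        have hx2 : (x : ℝ) ≤ M := by exact_mod_cast hx.2
        have hle : (2 * (x : ℝ) - (M + 1)) ^ 2 ≤ M ^ 2 := sq_le_sq' (by linarith) (by linarith)
        rw [abs_of_nonpos (by linarith [Real.cos_le_one ((2 * (x : ℝ) - (M + 1)) * (2 * v / M))])]
        have hc := Real.one_sub_sq_div_two_le_cos (x := (2 * (x : ℝ) - (M + 1)) * (2 * v / M))
        have : ((2 * (x : ℝ) - (M + 1)) * (2 * v / M)) ^ 2 / 2 ≤ 2 * v ^ 2 := by
          calc _ = (2 * (x : ℝ) - (M + 1)) ^ 2 * (2 * (v / M) ^ 2) := by ring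
            _ ≤ (M : ℝ) ^ 2 * (2 * (v / M) ^ 2) := by gcongr
            _ = 2 * v ^ 2 := by field
        linarith
    _ = 2 * v ^ 2 * M := by simp [mul_comm]

theorem abs_integral_mul_scaledDirichletSum_pow_sub_le {M : ℕ} (hM : 2 ≤ M) {g : ℝ → ℝ}
    (hg : Continuous g) (hg1 : ∀ v, |g v| ≤ 1) (n : ℕ) :
    |(∫ v in (0 : ℝ)..(M * (Real.pi / 2)), g v * scaledDirichletSum M v ^ n) -
      ∫ v in (0 : ℝ)..2, g v * Real.sinc v ^ n| ≤
      2 * n / M ^ 2 + 2 * M * (Real.pi / 4) ^ n := by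
  have hM2 : (2 : ℝ) ≤ M := by exact_mod_cast hM
  have hM0 : M ≠ 0 := by omega
  have hpi := Real.pi_gt_three
  have hpi4 := Real.pi_lt_four
  have hb : 2 ≤ M * (Real.pi / 2) := by nlinarith
  have hK := continuous_scaledDirichletSum M
  have hs := Real.continuous_sinc
  have hi (a b : ℝ) : IntervalIntegrable (fun v => g v * scaledDirichletSum M v ^ n)
      MeasureTheory.volume a b := Continuous.intervalIntegrable (by fun_prop) _ _
  have hi' (a b : ℝ) : IntervalIntegrable (fun v => g v * Real.sinc v ^ n)
      MeasureTheory.volume a b := Continuous.intervalIntegrable (by fun_prop) _ _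
  rw [← intervalIntegral.integral_add_adjacent_intervals (hi 0 2) (hi 2 _), add_sub_right_comm,
    ← intervalIntegral.integral_sub (hi 0 2) (hi' 0 2)]
  have hA : |∫ v in (0 : ℝ)..2, (g v * scaledDirichletSum M v ^ n - g v * Real.sinc v ^ n)| ≤
      2 * n / M ^ 2 := by
    have := intervalIntegral.norm_integral_le_of_norm_le_const
      (f := fun v => g v * scaledDirichletSum M v ^ n - g v * Real.sinc v ^ n)
      (a := 0) (b := 2) (C := n / M ^ 2) (fun v hv => by
        rw [Set.uIoc_of_le zero_le_two] at hv
        rw [Real.norm_eq_abs, ← mul_sub, abs_mul]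
        have hmax : max |scaledDirichletSum M v| |Real.sinc v| ≤ 1 :=
          max_le (abs_scaledDirichletSum_le_one M v) (Real.abs_sinc_le_one v)
        calc _ ≤ 1 * (1 / (M : ℝ) ^ 2 * n * 1) := by
              refine mul_le_mul (hg1 v) ((abs_pow_sub_pow_le _ _ _).trans ?_) (abs_nonneg _)
                zero_le_one
              gcongr
              · exact abs_scaledDirichletSum_sub_sinc_le hM0 hv.1 hv.2
              · exact pow_le_one₀ (le_max_of_le_left (abs_nonneg _)) hmax
          _ = n / M ^ 2 := by ring)
    rw [Real.norm_eq_abs, sub_zero, abs_two] at this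
    exact this.trans_eq (by ring)
  have hB : |∫ v in (2 : ℝ)..(M * (Real.pi / 2)), g v * scaledDirichletSum M v ^ n| ≤
      2 * M * (Real.pi / 4) ^ n := by
    have := intervalIntegral.norm_integral_le_of_norm_le_const
      (f := fun v => g v * scaledDirichletSum M v ^ n)
      (a := 2) (b := M * (Real.pi / 2)) (C := (Real.pi / 4) ^ n) (fun v hv => by
        rw [Set.uIoc_of_le hb] at hv
        rw [Real.norm_eq_abs, abs_mul, abs_pow]
        refine (mul_le_of_le_one_left (by positivity) (hg1 v)).trans ?_
        gcongr
        exact abs_scaledDirichletSum_le_pi_div_four hM0 hv.1.le hv.2)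
    rw [Real.norm_eq_abs, abs_of_nonneg (sub_nonneg.2 hb)] at this
    refine this.trans ?_
    rw [mul_comm]
    gcongr
    nlinarith
  exact (abs_add_le _ _).trans (add_le_add hA hB)

theorem integral_symm_eq_of_even {F : ℝ → ℝ} (hF : Continuous F) (he : ∀ u, F (-u) = F u)
    {c : ℝ} (hc : c ≠ 0) (a : ℝ) :
    ∫ u in (-a)..a, F u = 2 / c * ∫ v in (0 : ℝ)..(c * a), F (v / c) := by
  have h1 : ∫ u in (-a)..0, F u = ∫ u in (0 : ℝ)..a, F u := by
    have := intervalIntegral.integral_comp_neg (a := 0) (b := a) F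
    simpa [he] using this.symm
  rw [← intervalIntegral.integral_add_adjacent_intervals (hF.intervalIntegrable _ 0)
    (hF.intervalIntegrable _ _), h1, intervalIntegral.integral_comp_div F hc, zero_div,
    mul_div_cancel_left₀ _ hc, smul_eq_mul]
  field

theorem integral_dirichletSum_pow {M : ℕ} (hM : M ≠ 0) {N : ℕ} (hN : N ≠ 0) :
    ∫ u in (-(Real.pi / 2))..(Real.pi / 2), dirichletSum M u ^ N =
      2 * M ^ (N - 1) * ∫ v in (0 : ℝ)..(M * (Real.pi / 2)), scaledDirichletSum M v ^ N := by
  have hM' : (M : ℝ) ≠ 0 := Nat.cast_ne_zero.2 hM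
  have hD := continuous_dirichletSum M
  obtain ⟨k, rfl⟩ := Nat.exists_eq_succ_of_ne_zero hN
  rw [integral_symm_eq_of_even (by fun_prop) (fun u => by rw [dirichletSum_neg]) hM',
    Nat.succ_sub_one]
  have e (v : ℝ) : dirichletSum M (v / M) ^ (k + 1) =
      M ^ (k + 1) * scaledDirichletSum M v ^ (k + 1) := by
    rw [← mul_pow, scaledDirichletSum, mul_div_cancel₀ _ hM']
  simp only [Nat.succ_eq_add_one, e, intervalIntegral.integral_const_mul]
  field

theorem integral_dirichletSum_two_mul_mul_pow {M : ℕ} (hM : M ≠ 0) (N : ℕ) :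
    ∫ u in (-(Real.pi / 2))..(Real.pi / 2), dirichletSum M (2 * u) * dirichletSum M u ^ (N - 2) =
      2 * M ^ (N - 2) * ∫ v in (0 : ℝ)..(M * (Real.pi / 2)),
        scaledDirichletSum M (2 * v) * scaledDirichletSum M v ^ (N - 2) := by
  have hM' : (M : ℝ) ≠ 0 := Nat.cast_ne_zero.2 hM
  have hD := continuous_dirichletSum M
  rw [integral_symm_eq_of_even (by fun_prop)
    (fun u => by rw [dirichletSum_neg, mul_neg, dirichletSum_neg]) hM']
  have e (v : ℝ) : dirichletSum M (2 * (v / M)) * dirichletSum M (v / M) ^ (N - 2) =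
      M * M ^ (N - 2) * (scaledDirichletSum M (2 * v) * scaledDirichletSum M v ^ (N - 2)) := by
    rw [scaledDirichletSum, scaledDirichletSum, div_pow, mul_div_assoc]
    field
  simp only [e, intervalIntegral.integral_const_mul]
  field

/-- The integral measuring all `N`-tuples from `{1,…,N⁴}` with the magic sum. -/
noncomputable def tupleIntegral (N : ℕ) : ℝ :=
  ∫ v in (0 : ℝ)..((N ^ 4 : ℕ) * (Real.pi / 2)), scaledDirichletSum (N ^ 4) v ^ N

/-- The integral measuring the `N`-tuples with the magic sum and two prescribed equal entries. -/
noncomputable def coincidenceIntegral (N : ℕ) : ℝ :=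
  ∫ v in (0 : ℝ)..((N ^ 4 : ℕ) * (Real.pi / 2)),
    scaledDirichletSum (N ^ 4) (2 * v) * scaledDirichletSum (N ^ 4) v ^ (N - 2)

theorem two_mul_magicConstant (N : ℕ) :
    2 * (N * (N ^ 4 + 1) / 2) = N * (N ^ 4 + 1) := by
  refine Nat.mul_div_cancel' (even_iff_two_dvd.1 ?_)
  rcases Nat.even_or_odd N with h | h
  · exact h.mul_right _
  · exact (h.pow.add_odd odd_one).mul_left _

theorem abs_factorial_mul_magicTesseractSeries_sub_le {N : ℕ} (hN : 5 ≤ N) :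
    |(N.factorial : ℝ) * magicTesseractSeries N / ((N : ℝ) ^ 4) ^ (N - 1) -
      2 / Real.pi * (tupleIntegral N - N.choose 2 / (N : ℝ) ^ 4 * coincidenceIntegral N)| ≤
      1 / (N : ℝ) ^ 4 := by
  have hN0 : N ≠ 0 := by omega
  have hM : N ^ 4 ≠ 0 := pow_ne_zero 4 hN0
  have hNR : (0 : ℝ) < N := Nat.cast_pos.2 (Nat.pos_of_ne_zero hN0)
  have hpi := Real.pi_pos
  have hs := two_mul_magicConstant N
  set A := tuplesWithSum N (N ^ 4) (N * (N ^ 4 + 1) / 2) with hA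
  have hinj : ((A.filter Function.Injective).card : ℝ) =
      (N.factorial : ℝ) * magicTesseractSeries N := by
    rw [hA, card_filter_injective_tuplesWithSum, magicTesseractSeries, Nat.cast_mul, mul_comm]
  have hT : (A.card : ℝ) = 2 * ((N : ℝ) ^ 4) ^ (N - 1) * tupleIntegral N / Real.pi := by
    rw [eq_div_iff hpi.ne', mul_comm, pi_mul_card_tuplesWithSum hs,
      integral_dirichletSum_pow hM hN0, tupleIntegral, Nat.cast_pow]
  have hQ : ∑ p ∈ indexPairs N, ((A.filter (fun f => f p.1 = f p.2)).card : ℝ) =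
      N.choose 2 * (2 * ((N : ℝ) ^ 4) ^ (N - 2) * coincidenceIntegral N / Real.pi) := by
    rw [← card_indexPairs, ← nsmul_eq_mul]
    refine Finset.sum_eq_card_nsmul fun p hp => ?_
    rw [eq_div_iff hpi.ne', mul_comm, pi_mul_card_filter_coincidence hs hp,
      integral_dirichletSum_two_mul_mul_pow hM, coincidenceIntegral, Nat.cast_pow]
  have hW : ∑ q ∈ (indexPairs N).offDiag,
      ((A.filter (fun f => f q.1.1 = f q.1.2 ∧ f q.2.1 = f q.2.2)).card : ℝ) ≤
      (N : ℝ) ^ 4 * ((N : ℝ) ^ 4) ^ (N - 3) := by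
    refine (Finset.sum_le_card_nsmul _ _ (((N : ℝ) ^ 4) ^ (N - 3)) fun q hq => ?_).trans ?_
    · exact_mod_cast card_tuplesWithSum_two_coincidences_le hN hq
    · rw [nsmul_eq_mul]
      gcongr
      have h1 : (indexPairs N).offDiag.card ≤ N.choose 2 * N.choose 2 := by
        rw [Finset.offDiag_card, card_indexPairs]
        exact Nat.sub_le _ _
      have h2 : N.choose 2 * N.choose 2 ≤ N ^ 4 := by
        calc _ ≤ N ^ 2 * N ^ 2 := Nat.mul_le_mul (Nat.choose_le_pow _ _) (Nat.choose_le_pow _ _)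
          _ = N ^ 4 := by ring
      exact_mod_cast h1.trans h2
  have h := (abs_card_filter_injective_sub_le A).trans hW
  obtain ⟨k, rfl⟩ : ∃ k, N = k + 3 := ⟨N - 3, by omega⟩
  rw [hinj, hT, hQ] at h
  set m : ℝ := ((k + 3 : ℕ) : ℝ) ^ 4 with hm
  have hm0 : 0 < m := by positivity
  have e1 : k + 3 - 1 = k + 2 := rfl
  have e2 : k + 3 - 2 = k + 1 := rfl
  have e3 : k + 3 - 3 = k := rfl
  rw [e1, e2, e3] at h
  rw [e1]
  have hdiv := div_le_div_of_nonneg_right h (pow_pos hm0 (k + 2)).le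
  rw [← abs_of_pos (pow_pos hm0 (k + 2)), ← abs_div, abs_of_pos (pow_pos hm0 (k + 2))] at hdiv
  refine le_of_eq_of_le (congrArg _ ?_) (hdiv.trans_eq ?_) <;> field

theorem isBigO_one_div_pow {f : ℕ → ℝ} (C : ℝ) (k n₀ : ℕ)
    (h : ∀ N : ℕ, n₀ ≤ N → |f N| ≤ C / (N : ℝ) ^ k) :
    f =O[atTop] fun N : ℕ => 1 / (N : ℝ) ^ k := by
  refine IsBigO.of_bound C (eventually_atTop.2 ⟨n₀, fun N hN => ?_⟩)
  rw [Real.norm_eq_abs, Real.norm_eq_abs, abs_of_nonneg (by positivity : 0 ≤ 1 / (N : ℝ) ^ k),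
    mul_one_div]
  exact h N hN

theorem isBigO_one_div_pow_of_le {k l : ℕ} (h : k ≤ l) :
    (fun N : ℕ => 1 / (N : ℝ) ^ l) =O[atTop] fun N : ℕ => 1 / (N : ℝ) ^ k := by
  refine isBigO_one_div_pow 1 k 1 fun N hN => ?_
  have hN1 : (1 : ℝ) ≤ N := by exact_mod_cast hN
  rw [abs_of_nonneg (by positivity)]
  gcongr

theorem isBigO_sqrt_mul_truncation_error (k : ℕ) :
    (fun N : ℕ => √(N : ℝ) * (2 * (N - k : ℕ) / ((N ^ 4 : ℕ) : ℝ) ^ 2 +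
      2 * (N ^ 4 : ℕ) * (Real.pi / 4) ^ (N - k))) =O[atTop] fun N : ℕ => 1 / (N : ℝ) ^ 3 := by
  have hpi := Real.pi_pos
  have hlim := tendsto_pow_const_mul_const_pow_of_abs_lt_one 8 (r := Real.pi / 4)
    (by rw [abs_of_pos (by positivity)]; linarith [Real.pi_lt_four])
  obtain ⟨n₀, hn₀⟩ := eventually_atTop.1 (hlim.eventually_le_const zero_lt_one)
  refine isBigO_one_div_pow (2 + 2 / (Real.pi / 4) ^ k) 3 (n₀ + k + 1) fun N hN => ?_
  have hN1 : (1 : ℝ) ≤ N := by exact_mod_cast (by omega : 1 ≤ N)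
  have hN0 : (0 : ℝ) < N := by linarith
  have hsqrt : √(N : ℝ) ≤ N := Real.sqrt_le_self_iff.2 (Or.inr hN1)
  have hr : (Real.pi / 4) ^ (N - k) ≤ 1 / (N : ℝ) ^ 8 / (Real.pi / 4) ^ k := by
    rw [le_div_iff₀ (by positivity), ← pow_add, Nat.sub_add_cancel (by omega),
      le_div_iff₀' (by positivity)]
    exact hn₀ N (by omega)
  have hk : ((N - k : ℕ) : ℝ) ≤ N := Nat.cast_le.2 (Nat.sub_le _ _)
  rw [abs_of_nonneg (by positivity), Nat.cast_pow]
  calc _ ≤ (N : ℝ) * (2 * N / ((N : ℝ) ^ 4) ^ 2 +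
        2 * (N : ℝ) ^ 4 * (1 / (N : ℝ) ^ 8 / (Real.pi / 4) ^ k)) := by gcongr
    _ = 2 * (1 / (N : ℝ) ^ 6) + 2 / (Real.pi / 4) ^ k * (1 / (N : ℝ) ^ 3) := by field
    _ ≤ 2 * (1 / (N : ℝ) ^ 3) + 2 / (Real.pi / 4) ^ k * (1 / (N : ℝ) ^ 3) := by
        gcongr
        norm_num
    _ = _ := by ring

theorem isBigO_sqrt_mul_tupleIntegral_sub :
    (fun N : ℕ => √(N : ℝ) * tupleIntegral N - √(6 * Real.pi) / 2 *
      (1 - 3 / (20 * (N : ℝ)) - 13 / (1120 * (N : ℝ) ^ 2))) =O[atTop]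
      fun N : ℕ => 1 / (N : ℝ) ^ 3 := by
  obtain ⟨C, hC⟩ := exists_abs_integral_sinc_pow_sub_le
  have h1 := isBigO_one_div_pow C 3 2 hC
  have h2 : (fun N : ℕ => √(N : ℝ) * tupleIntegral N -
      √(N : ℝ) * ∫ v in (0 : ℝ)..2, Real.sinc v ^ N) =O[atTop] fun N : ℕ => 1 / (N : ℝ) ^ 3 := by
    refine IsBigO.trans (IsBigO.of_bound 1 ?_) (isBigO_sqrt_mul_truncation_error 0)
    filter_upwards [eventually_ge_atTop 2] with N hN
    have hM : 2 ≤ N ^ 4 := hN.trans (Nat.le_self_pow (by norm_num) N)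
    have h := abs_integral_mul_scaledDirichletSum_pow_sub_le hM (g := fun _ => 1)
      continuous_const (fun _ => by simp) N
    simp only [one_mul] at h
    rw [one_mul, ← mul_sub, norm_mul, norm_mul]
    refine mul_le_mul_of_nonneg_left (h.trans (le_abs_self _)) (norm_nonneg _)
  simpa only [sub_add_sub_cancel] using h2.add h1

theorem isBigO_sqrt_mul_coincidenceIntegral_sub :
    (fun N : ℕ => √(N : ℝ) * coincidenceIntegral N - √(6 * Real.pi) / 2) =O[atTop]
      fun N : ℕ => 1 / (N : ℝ) ^ 1 := by
  obtain ⟨C, hC⟩ := exists_abs_integral_mul_sinc_pow_sub_le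
  obtain ⟨C', hC'⟩ := exists_abs_integral_sinc_pow_sub_le
  have h1 := (isBigO_one_div_pow C' 3 2 hC').trans (isBigO_one_div_pow_of_le (by norm_num : 1 ≤ 3))
  have h2 : (fun N : ℕ => √(N : ℝ) * (∫ v in (0 : ℝ)..2,
        scaledDirichletSum (N ^ 4) (2 * v) * Real.sinc v ^ (N - 2)) -
      √(N : ℝ) * ∫ v in (0 : ℝ)..2, Real.sinc v ^ N) =O[atTop] fun N : ℕ => 1 / (N : ℝ) ^ 1 := by
    refine isBigO_one_div_pow C 1 4 fun N hN => ?_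
    rw [pow_one]
    exact hC N _ hN ((continuous_scaledDirichletSum _).comp (continuous_const_mul 2))
      (abs_scaledDirichletSum_two_mul_sub_one_le (pow_ne_zero 4 (by omega)))
  have h3 : (fun N : ℕ => √(N : ℝ) * coincidenceIntegral N - √(N : ℝ) * (∫ v in (0 : ℝ)..2,
        scaledDirichletSum (N ^ 4) (2 * v) * Real.sinc v ^ (N - 2))) =O[atTop]
      fun N : ℕ => 1 / (N : ℝ) ^ 1 := by
    refine IsBigO.trans (IsBigO.of_bound 1 ?_) ((isBigO_sqrt_mul_truncation_error 2).trans
      (isBigO_one_div_pow_of_le (by norm_num)))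
    filter_upwards [eventually_ge_atTop 2] with N hN
    have hM : 2 ≤ N ^ 4 := hN.trans (Nat.le_self_pow (by norm_num) N)
    have h := abs_integral_mul_scaledDirichletSum_pow_sub_le hM
      (g := fun v => scaledDirichletSum (N ^ 4) (2 * v))
      ((continuous_scaledDirichletSum _).comp (continuous_const_mul 2))
      (fun _ => abs_scaledDirichletSum_le_one _ _) (N - 2)
    rw [one_mul, ← mul_sub, norm_mul, norm_mul]
    refine mul_le_mul_of_nonneg_left (h.trans (le_abs_self _)) (norm_nonneg _)
  have h4 : (fun N : ℕ => √(6 * Real.pi) / 2 *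
      (1 - 3 / (20 * (N : ℝ)) - 13 / (1120 * (N : ℝ) ^ 2)) - √(6 * Real.pi) / 2) =O[atTop]
      fun N : ℕ => 1 / (N : ℝ) ^ 1 := by
    refine isBigO_one_div_pow (√(6 * Real.pi) / 2) 1 1 fun N hN => ?_
    have hN1 : (1 : ℝ) ≤ N := by exact_mod_cast hN
    have e : √(6 * Real.pi) / 2 * (1 - 3 / (20 * (N : ℝ)) - 13 / (1120 * (N : ℝ) ^ 2)) -
        √(6 * Real.pi) / 2 = -(√(6 * Real.pi) / 2 *
          (3 / 20 * (1 / (N : ℝ)) + 13 / 1120 * (1 / (N : ℝ) ^ 2))) := by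
      field
    have h2 : 1 / (N : ℝ) ^ 2 ≤ 1 / (N : ℝ) ^ 1 :=
      one_div_le_one_div_of_le (by positivity) (pow_le_pow_right₀ hN1 (by norm_num))
    have h0 : 0 ≤ 1 / (N : ℝ) ^ 1 := by positivity
    rw [pow_one] at h2 h0
    rw [e, abs_neg, abs_of_nonneg (by positivity), pow_one, ← mul_one_div (_ / _) (N : ℝ)]
    exact mul_le_mul_of_nonneg_left (by linarith) (by positivity)
  simpa only [sub_add_sub_cancel] using ((h3.add h2).add h1).add h4

/-- The number of injective tuples, normalised, up to a relative error `O(1 / N³)`. -/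
theorem isBigO_factorial_mul_magicTesseractSeries_sub :
    (fun N : ℕ => √Real.pi / √6 * (√(N : ℝ) *
        ((N.factorial : ℝ) * magicTesseractSeries N / ((N : ℝ) ^ 4) ^ (N - 1))) -
      (1 - 3 / (20 * (N : ℝ)) - (13 / 1120 + 1 / 2) / (N : ℝ) ^ 2)) =O[atTop]
      fun N : ℕ => 1 / (N : ℝ) ^ 3 := by
  have h1 : (fun N : ℕ => √(N : ℝ) *
        ((N.factorial : ℝ) * magicTesseractSeries N / ((N : ℝ) ^ 4) ^ (N - 1)) -
      √(N : ℝ) * (2 / Real.pi * (tupleIntegral N -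
        N.choose 2 / (N : ℝ) ^ 4 * coincidenceIntegral N))) =O[atTop]
      fun N : ℕ => 1 / (N : ℝ) ^ 3 := by
    refine isBigO_one_div_pow 1 3 5 fun N hN => ?_
    have hN1 : (1 : ℝ) ≤ N := by exact_mod_cast (by omega : 1 ≤ N)
    have hsqrt : √(N : ℝ) ≤ N := Real.sqrt_le_self_iff.2 (Or.inr hN1)
    rw [← mul_sub, abs_mul, abs_of_nonneg (Real.sqrt_nonneg _)]
    calc _ ≤ (N : ℝ) * (1 / (N : ℝ) ^ 4) :=
          mul_le_mul hsqrt (abs_factorial_mul_magicTesseractSeries_sub_le hN) (abs_nonneg _)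
            N.cast_nonneg
      _ = 1 / (N : ℝ) ^ 3 := by field
  have h2 := isBigO_sqrt_mul_tupleIntegral_sub
  have hchoose : (fun N : ℕ => (N.choose 2 : ℝ) / (N : ℝ) ^ 4) =O[atTop]
      fun N : ℕ => 1 / (N : ℝ) ^ 2 := by
    refine isBigO_one_div_pow 1 2 1 fun N hN => ?_
    have hN0 : (0 : ℝ) < N := by exact_mod_cast hN
    rw [abs_of_nonneg (by positivity), div_le_div_iff₀ (by positivity) (by positivity), one_mul]
    have : (N.choose 2 : ℝ) ≤ (N : ℝ) ^ 2 := by exact_mod_cast Nat.choose_le_pow N 2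
    calc _ ≤ (N : ℝ) ^ 2 * (N : ℝ) ^ 2 := by gcongr
      _ = (N : ℝ) ^ 4 := by ring
  have h3 : (fun N : ℕ => (N.choose 2 : ℝ) / (N : ℝ) ^ 4 *
      (√(N : ℝ) * coincidenceIntegral N - √(6 * Real.pi) / 2)) =O[atTop]
      fun N : ℕ => 1 / (N : ℝ) ^ 3 := by
    refine (hchoose.mul isBigO_sqrt_mul_coincidenceIntegral_sub).congr_right fun N => ?_
    rw [one_div_mul_one_div, ← pow_add]
  have h4 : (fun N : ℕ => (N.choose 2 : ℝ) / (N : ℝ) ^ 4 - 1 / (2 * (N : ℝ) ^ 2)) =O[atTop]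
      fun N : ℕ => 1 / (N : ℝ) ^ 3 := by
    refine isBigO_one_div_pow (1 / 2) 3 1 fun N hN => ?_
    have hN0 : (0 : ℝ) < N := by exact_mod_cast hN
    have e : (N.choose 2 : ℝ) / (N : ℝ) ^ 4 - 1 / (2 * (N : ℝ) ^ 2) =
        -(1 / 2 / (N : ℝ) ^ 3) := by
      rw [Nat.cast_choose_two]
      field
    rw [e, abs_neg, abs_of_nonneg (by positivity)]
  have key := ((h1.const_mul_left (√Real.pi / √6)).add
    ((h2.sub (h3.add (h4.const_mul_left (√(6 * Real.pi) / 2)))).const_mul_left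
      (√Real.pi / √6 * (2 / Real.pi))))
  refine key.congr_left fun N => ?_
  have e6 : √Real.pi / √6 * (2 / Real.pi) * (√(6 * Real.pi) / 2) = 1 := by
    have h6 : √(6 : ℝ) ≠ 0 := by positivity
    rw [Real.sqrt_mul (by norm_num : (0 : ℝ) ≤ 6)]
    field_simp
    exact Real.sq_sqrt Real.pi_pos.le
  linear_combination (-(1 - 3 / (20 * (N : ℝ)) - 13 / (1120 * (N : ℝ) ^ 2)) +
    1 / (2 * (N : ℝ) ^ 2)) * e6

/-- The reciprocal form of Stirling's series to second order. -/
theorem isBigO_sqrt_pi_div_stirlingSeq_sub :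
    (fun N : ℕ => √Real.pi / Stirling.stirlingSeq N -
      (1 - 1 / (12 * (N : ℝ)) + 1 / (288 * (N : ℝ) ^ 2))) =O[atTop]
      fun N : ℕ => 1 / (N : ℝ) ^ 3 := by
  refine isBigO_one_div_pow 2 3 4 fun N hN => ?_
  have hN4 : (4 : ℝ) ≤ N := by exact_mod_cast hN
  have hN0 : (0 : ℝ) < N := by linarith
  have hst : 0 < Stirling.stirlingSeq N := by
    obtain ⟨k, rfl⟩ := Nat.exists_eq_succ_of_ne_zero (by omega : N ≠ 0)
    exact Stirling.stirlingSeq'_pos k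
  have hpi : 0 < √Real.pi := Real.sqrt_pos.2 Real.pi_pos
  set x := Real.log (Stirling.stirlingSeq N) - Real.log √Real.pi with hx
  have hxe : √Real.pi / Stirling.stirlingSeq N = Real.exp (-x) := by
    rw [hx, neg_sub, Real.exp_sub, Real.exp_log hst, Real.exp_log hpi]
  have hd := Stirling.abs_log_stirlingSeq_sub_le N (by omega)
  rw [← hx] at hd
  set t : ℝ := 1 / N with ht
  have e1 : 1 / (12 * (N : ℝ)) = t / 12 := by rw [ht]; field
  have e2 : 1 / (288 * (N : ℝ) ^ 2) = t ^ 2 / 288 := by rw [ht]; field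
  have e3 : 1 / (N : ℝ) ^ 3 = t ^ 3 := by rw [ht]; field
  have e4 : 2 / (N : ℝ) ^ 3 = 2 * t ^ 3 := by rw [ht]; field
  have ht0 : 0 < t := by positivity
  have ht4 : t ≤ 1 / 4 := one_div_le_one_div_of_le (by norm_num) hN4
  rw [e1, e3] at hd
  rw [e1, e2, e4, hxe]
  have ht2 : t ^ 2 ≤ 1 / 16 := by nlinarith
  have ht3 : t ^ 3 ≤ t / 16 := by nlinarith
  have hd' := abs_le.1 hd
  have hx0 : 0 ≤ x := by linarith
  have hx1 : x ≤ t := by linarith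
  have h1 : |Real.exp (-x) - (1 - x + x ^ 2 / 2)| ≤ t ^ 3 :=
    (Real.abs_exp_neg_sub_quadratic_le hx0).trans (by gcongr)
  have h2 : |(1 - x + x ^ 2 / 2) - (1 - t / 12 + t ^ 2 / 288)| ≤ t ^ 3 := by
    have e : (1 - x + x ^ 2 / 2) - (1 - t / 12 + t ^ 2 / 288) =
        (x - t / 12) * (-1 + (x + t / 12) / 2) := by ring
    rw [e, abs_mul]
    refine (mul_le_of_le_one_right (abs_nonneg _) ?_).trans hd
    rw [abs_le]
    constructor <;> linarith
  calc _ ≤ |Real.exp (-x) - (1 - x + x ^ 2 / 2)| +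
        |(1 - x + x ^ 2 / 2) - (1 - t / 12 + t ^ 2 / 288)| := abs_sub_le _ _ _
    _ ≤ 2 * t ^ 3 := by linarith

theorem normalized_magicTesseractSeries_eq {N : ℕ} (hN : N ≠ 0) :
    Real.pi / √3 * (N : ℝ) ^ 5 * (((N : ℝ) ^ 3 * Real.exp 1) ^ N)⁻¹ * magicTesseractSeries N =
      √Real.pi / √6 * (√(N : ℝ) *
        ((N.factorial : ℝ) * magicTesseractSeries N / ((N : ℝ) ^ 4) ^ (N - 1))) *
      (√Real.pi / Stirling.stirlingSeq N) := by
  obtain ⟨k, rfl⟩ := Nat.exists_eq_succ_of_ne_zero hN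
  have hk : (0 : ℝ) < (k.succ : ℕ) := by positivity
  have hf : (k.succ.factorial : ℝ) ≠ 0 := Nat.cast_ne_zero.2 (Nat.factorial_ne_zero _)
  have h6 : √(6 : ℝ) = √2 * √3 := by
    rw [← Real.sqrt_mul (by norm_num)]
    norm_num
  have h2 : √(2 : ℝ) ≠ 0 := by positivity
  have h3 : √(3 : ℝ) ≠ 0 := by positivity
  have hs : √((k.succ : ℕ) : ℝ) ≠ 0 := (Real.sqrt_pos.2 hk).ne'
  have he := (Real.exp_pos 1).ne'
  rw [Stirling.stirlingSeq, h6, Real.sqrt_mul (by norm_num : (0 : ℝ) ≤ 2), Nat.succ_sub_one,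
    mul_pow, div_pow, ← pow_mul, ← pow_mul]
  generalize magicTesseractSeries k.succ = m
  generalize Real.exp 1 ^ k.succ = E
  generalize (k.succ : ℝ) = n at *
  field_simp
  rw [Real.sq_sqrt hk.le, Real.sq_sqrt Real.pi_pos.le, Nat.succ_eq_add_one]
  ring

/-- Second-order asymptotic expansion for the number of 4-dimensional hypercube magic
series: `𝒩₄(N) = (√3/π) (N³e)^N / N⁵ (1 - 7/(30N) - 1249/(2520N²) + O(1/N³))`, stated
as `(π/√3) N⁵ (N³e)^{-N} 𝒩₄(N) - (1 - 7/(30N) - 1249/(2520N²)) = O(1/N³)`. -/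
theorem magic_tesseract_series_asymptotics :
    (fun N : ℕ =>
        Real.pi / Real.sqrt 3 * (N : ℝ) ^ 5 *
            (((N : ℝ) ^ 3 * Real.exp 1) ^ N)⁻¹ * (magicTesseractSeries N : ℝ) -
          (1 - 7 / (30 * (N : ℝ)) - 1249 / (2520 * (N : ℝ) ^ 2)))
      =O[atTop] fun N : ℕ => 1 / (N : ℝ) ^ 3 := by
  have hY := isBigO_factorial_mul_magicTesseractSeries_sub
  have hE := isBigO_sqrt_pi_div_stirlingSeq_sub
  have hprod : (fun N : ℕ => (1 - 3 / (20 * (N : ℝ)) - (13 / 1120 + 1 / 2) / (N : ℝ) ^ 2) *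
        (1 - 1 / (12 * (N : ℝ)) + 1 / (288 * (N : ℝ) ^ 2)) -
      (1 - 7 / (30 * (N : ℝ)) - 1249 / (2520 * (N : ℝ) ^ 2))) =O[atTop]
      fun N : ℕ => 1 / (N : ℝ) ^ 3 := by
    refine isBigO_one_div_pow 1 3 1 fun N hN => ?_
    have hN1 : (1 : ℝ) ≤ N := by exact_mod_cast hN
    have e : (1 - 3 / (20 * (N : ℝ)) - (13 / 1120 + 1 / 2) / (N : ℝ) ^ 2) *
        (1 - 1 / (12 * (N : ℝ)) + 1 / (288 * (N : ℝ) ^ 2)) -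
        (1 - 7 / (30 * (N : ℝ)) - 1249 / (2520 * (N : ℝ) ^ 2)) =
        (283 / 6720 - 191 / 107520 / N) * (1 / (N : ℝ) ^ 3) := by
      field
    have h0 : 0 < 1 / (N : ℝ) := by positivity
    have h1 : 1 / (N : ℝ) ≤ 1 := (div_le_one (by linarith)).2 hN1
    have h3 : 0 ≤ 1 / (N : ℝ) ^ 3 := by positivity
    rw [e, abs_mul, abs_of_nonneg h3]
    refine (mul_le_mul_of_nonneg_right ?_ h3).trans_eq (one_mul _)
    rw [← mul_one_div (191 / 107520) (N : ℝ), abs_le]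
    constructor <;> linarith
  have hR : (fun N : ℕ => 1 - 3 / (20 * (N : ℝ)) - (13 / 1120 + 1 / 2) / (N : ℝ) ^ 2) =O[atTop]
      fun _ => (1 : ℝ) := by
    refine IsBigO.of_bound 1 (eventually_atTop.2 ⟨1, fun N hN => ?_⟩)
    have hN1 : (1 : ℝ) ≤ N := by exact_mod_cast hN
    have h1 : 0 ≤ 3 / (20 * (N : ℝ)) := by positivity
    have h2 : 0 ≤ (13 / 1120 + 1 / 2) / (N : ℝ) ^ 2 := by positivity
    have h3 : 3 / (20 * (N : ℝ)) ≤ 3 / 20 :=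
      div_le_div_of_nonneg_left (by norm_num) (by norm_num) (by linarith)
    have h4 : (13 / 1120 + 1 / 2) / (N : ℝ) ^ 2 ≤ 13 / 1120 + 1 / 2 :=
      div_le_self (by norm_num) (one_le_pow₀ hN1)
    rw [Real.norm_eq_abs, norm_one, abs_le]
    constructor <;> linarith
  have hE1 : (fun N : ℕ => √Real.pi / Stirling.stirlingSeq N) =O[atTop] fun _ => (1 : ℝ) := by
    have hpi : √Real.pi ≠ 0 := Real.sqrt_ne_zero'.2 Real.pi_pos
    exact (tendsto_const_nhds.div Stirling.tendsto_stirlingSeq_sqrt_pi hpi).isBigO_one ℝ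
  have key := (((hY.mul hE1).congr_right fun N => mul_one _).add
    ((hR.mul hE).congr_right fun N => one_mul _)).add hprod
  refine key.congr' (eventually_atTop.2 ⟨1, fun N hN => ?_⟩) EventuallyEq.rfl
  simp only [normalized_magicTesseractSeries_eq (Nat.one_le_iff_ne_zero.1 hN)]
  ring
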